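/- Let n ≥ 2 and let A ∈ L^1(𝕋^n, Sym^+(n)) be a ℤ^n-periodic measurable matrix field with values in the symmetric nonnegative definite n×n matrices, which is divergence-free in the sense of distributions: ∫_{[0,1]^n} Σ_{i,j} A_{ij}(x) ∂_j Φ_i(x) dx = 0 for every ℤ^n-periodic Φ ∈ C^∞(ℝ^n, ℝ^n). Then the function x ↦ det(A(x))^{1/(n−1)} is integrable on [0,1]^n and ∫_{[0,1]^n} det(A(x))^{1/(n−1)} dx ≤ det( ∫_{[0,1]^n} A(x) dx )^{1/(n−1)}. -/

import Mathlib

open MeasureTheory Filter Topology ENNReal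

noncomputable section

/-- The fundamental domain `[0,1)^n` of the torus `𝕋^n = ℝ^n/ℤ^n`. -/
def box (n : ℕ) : Set (Fin n → ℝ) := Set.univ.pi fun _ => Set.Ico (0:ℝ) 1

/-- `ℤ^n`-periodicity of a function on `ℝ^n`. -/
def ZPeriodic {n : ℕ} {α : Type*} (f : (Fin n → ℝ) → α) : Prop :=
  ∀ (x : Fin n → ℝ) (m : Fin n → ℤ), f (x + fun i => (m i : ℝ)) = f x

/-- The operator norm of a real `n × n` matrix. -/
def opNorm {n : ℕ} (M : Matrix (Fin n) (Fin n) ℝ) : ℝ :=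
  ‖Matrix.toEuclideanCLM (𝕜 := ℝ) M‖

/-- The partial derivative `∂_j f (x)`. -/
def pd {n : ℕ} (f : (Fin n → ℝ) → ℝ) (j : Fin n) (x : Fin n → ℝ) : ℝ :=
  fderiv ℝ f x (Pi.single j 1)

/-- A bounded `ℝ^n`-valued Radon measure on the torus, encoded through the Jordan
decompositions of its components; it is concentrated on the fundamental domain. -/
structure VecMeasure (n : ℕ) where
  pos : Fin n → Measure (Fin n → ℝ)
  neg : Fin n → Measure (Fin n → ℝ)
  finpos : ∀ i, IsFiniteMeasure (pos i)
  finneg : ∀ i, IsFiniteMeasure (neg i)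
  supp_pos : ∀ i, pos i (box n)ᶜ = 0
  supp_neg : ∀ i, neg i (box n)ᶜ = 0

/-- The pairing `∫ Φ · dμ` of a vector-valued measure with a vector field. -/
def VecMeasure.pair {n : ℕ} (μ : VecMeasure n) (Φ : (Fin n → ℝ) → Fin n → ℝ) : ℝ :=
  ∑ i, ((∫ x, Φ x i ∂(μ.pos i)) - ∫ x, Φ x i ∂(μ.neg i))

/-- The total variation norm `‖μ‖_{M(𝕋^n,ℝ^n)}`. -/
def VecMeasure.normM {n : ℕ} (μ : VecMeasure n) : ℝ :=
  sSup { r | ∃ Φ : (Fin n → ℝ) → Fin n → ℝ, Continuous Φ ∧ ZPeriodic Φ ∧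
    (∀ x, Real.sqrt (∑ i, (Φ x i)^2) ≤ 1) ∧ r = μ.pair Φ }

/-- `div A = μ` in the sense of distributions on the torus:
`∫_{𝕋^n} Σ_{i,j} A_{ij} ∂_j Φ_i dx = - ∫ Φ · dμ` for all smooth periodic `Φ`. -/
def DivEq {n : ℕ} (A : (Fin n → ℝ) → Matrix (Fin n) (Fin n) ℝ) (μ : VecMeasure n) : Prop :=
  ∀ Φ : (Fin n → ℝ) → Fin n → ℝ, ContDiff ℝ (⊤ : ℕ∞) Φ → ZPeriodic Φ →
    (∫ x in box n, ∑ i, ∑ j, A x i j * pd (fun y => Φ y i) j x) = - μ.pair Φ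

section Torus

open scoped ComplexConjugate Matrix Convolution

/-- The squared Euclidean length of a frequency. -/
def freqSq {n : ℕ} (k : Fin n → ℤ) : ℝ := ∑ i, (k i : ℝ) ^ 2

lemma freqSq_nonneg {n : ℕ} (k : Fin n → ℤ) : 0 ≤ freqSq k :=
  Finset.sum_nonneg fun _ _ => sq_nonneg _

lemma one_le_freqSq {n : ℕ} {k : Fin n → ℤ} (hk : k ≠ 0) : 1 ≤ freqSq k := by
  obtain ⟨i, hi⟩ := Function.ne_iff.1 hk
  have h1 : (1 : ℝ) ≤ (k i : ℝ) ^ 2 := by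
    have : 1 ≤ (k i) ^ 2 := by
      have : 0 < (k i) ^ 2 := by simp only [Pi.zero_apply] at hi; positivity
      omega
    exact_mod_cast this
  exact h1.trans (Finset.single_le_sum (f := fun i => (k i : ℝ) ^ 2)
    (fun _ _ => sq_nonneg _) (Finset.mem_univ i))

lemma abs_freqSq_add_sub_le {n : ℕ} (k j : Fin n → ℤ) :
    |freqSq (k + j) - freqSq k| ≤ 2 * (√(freqSq k) * √(freqSq j)) + freqSq j := by
  have h : freqSq (k + j) - freqSq k = 2 * ∑ i, (k i : ℝ) * j i + freqSq j := by
    simp only [freqSq, Finset.mul_sum, ← Finset.sum_add_distrib, ← Finset.sum_sub_distrib]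
    refine Finset.sum_congr rfl fun i _ => ?_
    simp only [Pi.add_apply]; push_cast; ring
  have h1 : |∑ i, (k i : ℝ) * j i| ≤ √(freqSq k) * √(freqSq j) := by
    rw [← Real.sqrt_mul (freqSq_nonneg k)]
    exact Real.abs_le_sqrt (Finset.sum_mul_sq_le_sq_mul_sq _ _ _)
  rw [h]
  refine (abs_add_le _ _).trans ?_
  rw [abs_mul, abs_two, abs_of_nonneg (freqSq_nonneg j)]
  linarith

/-- A summable weight on the integer lattice. -/
def latticeWeight {n : ℕ} (k : Fin n → ℤ) : ℝ := ∏ i, (1 + (k i : ℝ) ^ 2)⁻¹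

lemma latticeWeight_nonneg {n : ℕ} (k : Fin n → ℤ) : 0 ≤ latticeWeight k :=
  Finset.prod_nonneg fun _ _ => by positivity

lemma summable_latticeWeight (n : ℕ) : Summable (latticeWeight : (Fin n → ℤ) → ℝ) := by
  have h1 : Summable fun m : ℤ => (1 + (m : ℝ) ^ 2)⁻¹ := by
    have h2 : Summable fun m : ℤ => 1 / (m : ℝ) ^ 2 :=
      Real.summable_one_div_int_pow.2 one_lt_two
    refine (h2.add (summable_of_hasFiniteSupport (f := fun m : ℤ => if m = 0 then (1 : ℝ) else 0)
      ((Set.finite_singleton 0).subset fun m => by simp))).of_nonneg_of_le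
      (fun m => by positivity) fun m => ?_
    by_cases hm : m = 0
    · simp [hm]
    · have : (m : ℝ) ≠ 0 := by exact_mod_cast hm
      simp only [hm, if_false, add_zero, one_div]
      gcongr
      linarith
  refine summable_of_sum_le (c := (∑' m : ℤ, (1 + (m : ℝ) ^ 2)⁻¹) ^ n)
    (fun k => latticeWeight_nonneg k) fun F => ?_
  let T : Fin n → Finset ℤ := fun i => F.image fun k => k i
  have hF : F ⊆ Fintype.piFinset T := fun k hk => by
    simp only [Fintype.mem_piFinset, T]
    exact fun i => Finset.mem_image_of_mem _ hk
  calc ∑ k ∈ F, latticeWeight k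
      ≤ ∑ k ∈ Fintype.piFinset T, latticeWeight k :=
        Finset.sum_le_sum_of_subset_of_nonneg hF fun k _ _ => latticeWeight_nonneg k
    _ = ∏ i, ∑ m ∈ T i, (1 + (m : ℝ) ^ 2)⁻¹ := by
        rw [Finset.prod_univ_sum]; rfl
    _ ≤ ∏ _i : Fin n, ∑' m : ℤ, (1 + (m : ℝ) ^ 2)⁻¹ := by
        refine Finset.prod_le_prod (fun i _ => Finset.sum_nonneg fun _ _ => by positivity)
          fun i _ => h1.sum_le_tsum _ fun _ _ => by positivity
    _ = _ := by simp

lemma inv_one_add_freqSq_pow_le {n : ℕ} (k : Fin n → ℤ) :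
    ((1 + freqSq k) ^ n)⁻¹ ≤ latticeWeight k := by
  rw [latticeWeight, Finset.prod_inv_distrib]
  have h : ∏ i, (1 + (k i : ℝ) ^ 2) ≤ (1 + freqSq k) ^ n := by
    calc ∏ i, (1 + (k i : ℝ) ^ 2) ≤ ∏ _i : Fin n, (1 + freqSq k) := by
          refine Finset.prod_le_prod (fun _ _ => by positivity) fun i _ => ?_
          have := Finset.single_le_sum (f := fun i => (k i : ℝ) ^ 2)
            (fun _ _ => sq_nonneg _) (Finset.mem_univ i)
          simp only [freqSq]; linarith
      _ = _ := by simp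
  exact inv_anti₀ (Finset.prod_pos fun _ _ => by positivity) h

/-- The Fourier multiplier `(1 + ε|k|²)^{-(n+1)}`. -/
def multiplier (n : ℕ) (ε : ℝ) (k : Fin n → ℤ) : ℝ := ((1 + ε * freqSq k) ^ (n + 1))⁻¹

lemma multiplier_pos {n : ℕ} {ε : ℝ} (hε : 0 < ε) (k : Fin n → ℤ) : 0 < multiplier n ε k := by
  have := freqSq_nonneg k
  unfold multiplier; positivity

lemma multiplier_le_one {n : ℕ} {ε : ℝ} (hε : 0 < ε) (k : Fin n → ℤ) :
    multiplier n ε k ≤ 1 := by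
  have := freqSq_nonneg k
  unfold multiplier
  exact inv_le_one_of_one_le₀ (one_le_pow₀ (by nlinarith))

lemma freqSq_mul_multiplier_sq_le {n : ℕ} {ε : ℝ} (hε : 0 < ε) (hε1 : ε ≤ 1) (k : Fin n → ℤ) :
    freqSq k * multiplier n ε k ^ 2 ≤ ((ε ^ (n + 1)) ^ 2)⁻¹ * latticeWeight k := by
  have hq := freqSq_nonneg k
  have h1 : multiplier n ε k ≤ (ε ^ (n + 1))⁻¹ * ((1 + freqSq k) ^ (n + 1))⁻¹ := by
    unfold multiplier
    rw [← mul_inv, ← mul_pow]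
    apply inv_anti₀ (by positivity)
    gcongr
    nlinarith
  have h2 := (multiplier_pos hε k).le
  have h3 : freqSq k * (((1 + freqSq k) ^ (n + 1))⁻¹) ^ 2 ≤ ((1 + freqSq k) ^ n)⁻¹ := by
    have h4 : freqSq k * (1 + freqSq k) ^ n ≤ ((1 + freqSq k) ^ (n + 1)) ^ 2 := by
      have h5 : (1 : ℝ) ≤ (1 + freqSq k) ^ (n + 1) := one_le_pow₀ (by linarith)
      have h6 : freqSq k * (1 + freqSq k) ^ n ≤ (1 + freqSq k) ^ (n + 1) := by
        rw [pow_succ, mul_comm]; gcongr; linarith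
      nlinarith
    rw [inv_pow, ← div_eq_mul_inv, div_le_iff₀ (by positivity), inv_mul_eq_div,
      le_div_iff₀ (by positivity)]
    exact h4
  calc freqSq k * multiplier n ε k ^ 2
      ≤ freqSq k * ((ε ^ (n + 1))⁻¹ * ((1 + freqSq k) ^ (n + 1))⁻¹) ^ 2 := by gcongr
    _ = ((ε ^ (n + 1)) ^ 2)⁻¹ * (freqSq k * (((1 + freqSq k) ^ (n + 1))⁻¹) ^ 2) := by
        rw [mul_pow, inv_pow]; ring
    _ ≤ _ := by
        gcongr
        exact h3.trans (inv_one_add_freqSq_pow_le k)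

lemma multiplier_ratio {n : ℕ} {D : ℝ} (hD : 0 ≤ D) {ε : ℝ} (hε : 0 < ε)
    {k j : Fin n → ℤ} (hk : k ≠ 0)
    (hj : 2 * √(freqSq j) + freqSq j ≤ D) :
    |1 - multiplier n ε k / multiplier n ε (k + j)| * √(freqSq k) ≤
      D * (n + 1 : ℕ) * (1 + D) ^ n * (ε * freqSq k / (1 + ε * freqSq k)) := by
  have hq := one_le_freqSq hk
  have hq' := freqSq_nonneg (k + j)
  have hs1 : 1 ≤ √(freqSq k) := by rw [Real.one_le_sqrt]; exact hq
  have hss : √(freqSq k) * √(freqSq k) = freqSq k := Real.mul_self_sqrt (by linarith)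
  set s := √(freqSq k)
  set q := freqSq k
  have hden : 0 < 1 + ε * q := by positivity
  set r := (1 + ε * freqSq (k + j)) / (1 + ε * q) with hr
  have hratio : multiplier n ε k / multiplier n ε (k + j) = r ^ (n + 1) := by
    unfold multiplier
    rw [hr, div_pow, inv_div_inv]
  have hdiff : |freqSq (k + j) - q| ≤ D * s := by
    refine (abs_freqSq_add_sub_le k j).trans ?_
    have := freqSq_nonneg j
    nlinarith
  have h1r : |1 - r| ≤ D * (ε * s / (1 + ε * q)) := by
    have : 1 - r = ε * (q - freqSq (k + j)) / (1 + ε * q) := by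
      rw [hr]; field_simp; ring
    rw [this, abs_div, abs_of_pos hden, abs_mul, abs_of_pos hε, abs_sub_comm, ← mul_div_assoc]
    refine div_le_div_of_nonneg_right ?_ hden.le
    nlinarith
  have hsq : ε * s / (1 + ε * q) ≤ 1 := by
    rw [div_le_one hden]; nlinarith
  have hr0 : 0 ≤ r := by positivity
  have hr1 : r ≤ 1 + D := by
    have := (abs_le.1 h1r).1
    nlinarith
  rw [hratio]
  have h2 := abs_pow_sub_pow_le (1 : ℝ) r (n + 1)
  rw [one_pow] at h2
  have h3 : max |(1 : ℝ)| |r| ^ (n + 1 - 1) ≤ (1 + D) ^ n := by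
    rw [Nat.add_sub_cancel, abs_one, abs_of_nonneg hr0]
    gcongr
    exact max_le (by linarith) hr1
  calc |1 - r ^ (n + 1)| * s
      ≤ (D * (ε * s / (1 + ε * q)) * (n + 1 : ℕ) * (1 + D) ^ n) * s := by
        gcongr
        exact h2.trans (by gcongr)
    _ = D * (n + 1 : ℕ) * (1 + D) ^ n * (ε * (s * s) / (1 + ε * q)) := by ring
    _ = _ := by rw [hss]

/-- Passing to the limit of finite truncations in a coercivity estimate. -/
lemma coercive_tsum {n : ℕ} {J : Finset (Fin n → ℤ)} {β : (Fin n → ℤ) → (Fin n → ℤ) → ℂ} {θ : ℝ}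
    (hcoer : ∀ (U : (Fin n → ℤ) → ℂ) (F : Finset (Fin n → ℤ)), (∀ k ∉ F, U k = 0) →
      θ * ∑ k ∈ F, freqSq k * ‖U k‖ ^ 2 ≤
        (∑ k ∈ F, ∑ j ∈ J, conj (U k) * β j k * U (k + j)).re)
    {U : (Fin n → ℤ) → ℂ} (hG : Summable fun k => freqSq k * ‖U k‖ ^ 2)
    (ht : ∀ j ∈ J, Summable fun k => ‖conj (U k) * β j k * U (k + j)‖) :
    θ * ∑' k, freqSq k * ‖U k‖ ^ 2 ≤ ‖∑' k, ∑ j ∈ J, conj (U k) * β j k * U (k + j)‖ := by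
  classical
  let V : Finset (Fin n → ℤ) → (Fin n → ℤ) → ℂ := fun F k => if k ∈ F then U k else 0
  have hVle : ∀ F k, ‖V F k‖ ≤ ‖U k‖ := fun F k => by
    by_cases h : k ∈ F <;> simp [V, h]
  have hVlim : ∀ k, Tendsto (fun F => V F k) atTop (𝓝 (U k)) := fun k => by
    refine tendsto_const_nhds.congr' ?_
    filter_upwards [eventually_ge_atTop ({k} : Finset (Fin n → ℤ))] with F hF
    simp [V, hF (Finset.mem_singleton_self k)]
  have h1 : Tendsto (fun F => ∑' k, ∑ j ∈ J, conj (V F k) * β j k * V F (k + j)) atTop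
      (𝓝 (∑' k, ∑ j ∈ J, conj (U k) * β j k * U (k + j))) := by
    refine tendsto_tsum_of_dominated_convergence
      (bound := fun k => ∑ j ∈ J, ‖conj (U k) * β j k * U (k + j)‖)
      (summable_sum fun j hj => ht j hj) (fun k => ?_) (Eventually.of_forall fun F k => ?_)
    · refine tendsto_finsetSum _ fun j _ => ?_
      exact (((Complex.continuous_conj.tendsto _).comp (hVlim k)).mul_const _).mul (hVlim (k + j))
    · refine (norm_sum_le _ _).trans (Finset.sum_le_sum fun j _ => ?_)
      simp only [norm_mul, RCLike.norm_conj]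
      gcongr <;> exact hVle _ _
  have h2 : ∀ F, θ * ∑ k ∈ F, freqSq k * ‖U k‖ ^ 2 ≤
      ‖∑' k, ∑ j ∈ J, conj (V F k) * β j k * V F (k + j)‖ := fun F => by
    have h3 := hcoer (V F) F fun k hk => by simp [V, hk]
    rw [tsum_eq_sum (s := F) fun k hk => by simp [V, hk]]
    refine le_trans (le_of_eq ?_) (h3.trans (Complex.re_le_norm _))
    congr 1
    exact Finset.sum_congr rfl fun k hk => by simp [V, hk]
  have h0 : Tendsto (fun F : Finset (Fin n → ℤ) => ∑ k ∈ F, freqSq k * ‖U k‖ ^ 2) atTop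
      (𝓝 (∑' k, freqSq k * ‖U k‖ ^ 2)) := by simpa [HasSum] using hG.hasSum
  exact le_of_tendsto_of_tendsto' (h0.const_mul θ) h1.norm h2

lemma absorb_bound {E κ M q τ ε u x R : ℝ} (hκ : 0 < κ) (hq : 0 ≤ q)
    (hτ0 : 0 ≤ τ) (hτ1 : τ ≤ 1) (hτ : τ ≤ ε * q) (hu0 : 0 ≤ u) (hu : u ≤ M)
    (hR : R = E ^ 2 / (4 * κ ^ 2)) :
    E * (τ * u) * x ≤ κ * x ^ 2 + κ * (q * u ^ 2) +
      if q < R then κ * R ^ 3 * M ^ 2 * ε ^ 2 else 0 := by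
  have hR0 : 0 ≤ R := by rw [hR]; positivity
  have h1 : E * (τ * u) * x ≤ κ * x ^ 2 + κ * R * (τ * u) ^ 2 := by
    have h2 : κ * R = E ^ 2 / (4 * κ) := by rw [hR]; field_simp
    have h3 : κ * x ^ 2 + κ * R * (τ * u) ^ 2 - E * (τ * u) * x =
        κ * (x - E * (τ * u) / (2 * κ)) ^ 2 := by
      rw [h2]; field_simp; ring
    have : 0 ≤ κ * (x - E * (τ * u) / (2 * κ)) ^ 2 := by positivity
    linarith
  have h4 : κ * R * (τ * u) ^ 2 ≤ κ * (q * u ^ 2) +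
      if q < R then κ * R ^ 3 * M ^ 2 * ε ^ 2 else 0 := by
    split_ifs with hqR
    · have hε : τ ≤ |ε| * R := hτ.trans (by
        have := le_abs_self ε
        have := abs_nonneg ε
        nlinarith)
      have h5 : (τ * u) ^ 2 ≤ (|ε| * R * M) ^ 2 := by gcongr
      have h6 : κ * R * (τ * u) ^ 2 ≤ κ * R * (|ε| * R * M) ^ 2 := by gcongr
      have h7 : κ * R * (|ε| * R * M) ^ 2 = κ * R ^ 3 * M ^ 2 * ε ^ 2 := by
        rw [mul_pow, mul_pow, sq_abs]; ring
      have : 0 ≤ κ * (q * u ^ 2) := by positivity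
      linarith
    · push Not at hqR
      have h5 : (τ * u) ^ 2 ≤ u ^ 2 := by
        gcongr
        nlinarith
      have : κ * R * (τ * u) ^ 2 ≤ κ * q * u ^ 2 := by gcongr
      linarith
  linarith

/-- A bounded solution of a coercive finite-range difference equation in Fourier space vanishes
away from the zero frequency. -/
lemma eq_zero_of_coercive {n : ℕ} {J : Finset (Fin n → ℤ)}
    {β : (Fin n → ℤ) → (Fin n → ℤ) → ℂ} {C θ M : ℝ} (hC : 0 ≤ C) (hθ : 0 < θ)
    (hβ : ∀ j ∈ J, ∀ k, ‖β j k‖ ≤ C * (√(freqSq k) * √(freqSq (k + j))))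
    (hcoer : ∀ (U : (Fin n → ℤ) → ℂ) (F : Finset (Fin n → ℤ)), (∀ k ∉ F, U k = 0) →
      θ * ∑ k ∈ F, freqSq k * ‖U k‖ ^ 2 ≤
        (∑ k ∈ F, ∑ j ∈ J, conj (U k) * β j k * U (k + j)).re)
    {m : (Fin n → ℤ) → ℂ} (hM : ∀ k, ‖m k‖ ≤ M)
    (heq : ∀ k, ∑ j ∈ J, β j k * m (k + j) = 0)
    {k₀ : Fin n → ℤ} (hk₀ : k₀ ≠ 0) : m k₀ = 0 := by
  obtain ⟨D, hD0, hD⟩ : ∃ D : ℝ, 0 ≤ D ∧ ∀ j ∈ J, 2 * √(freqSq j) + freqSq j ≤ D := by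
    have h0 : ∀ j : Fin n → ℤ, 0 ≤ 2 * √(freqSq j) + freqSq j := fun j => by
      have := freqSq_nonneg j; positivity
    exact ⟨∑ j ∈ J, (2 * √(freqSq j) + freqSq j), Finset.sum_nonneg fun j _ => h0 j,
      fun j hj => Finset.single_le_sum (f := fun j => 2 * √(freqSq j) + freqSq j)
        (fun j _ => h0 j) hj⟩
  obtain ⟨E, hE⟩ : ∃ E : ℝ, E = C * (D * (n + 1 : ℕ) * (1 + D) ^ n) := ⟨_, rfl⟩
  have hE0 : 0 ≤ E := by rw [hE]; positivity
  obtain ⟨κ, hκ⟩ : ∃ κ : ℝ, κ = θ / (4 * (J.card + 1)) := ⟨_, rfl⟩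
  have hκ0 : 0 < κ := by rw [hκ]; positivity
  obtain ⟨R, hR⟩ : ∃ R : ℝ, R = E ^ 2 / (4 * κ ^ 2) := ⟨_, rfl⟩
  have hR0 : 0 ≤ R := by rw [hR]; positivity
  obtain ⟨K, hK⟩ : ∃ K : ℝ, K = κ * R ^ 3 * M ^ 2 * (1 + R) ^ n := ⟨_, rfl⟩
  have hK0 : 0 ≤ K := by rw [hK]; positivity
  obtain ⟨Z, hZ⟩ : ∃ Z : ℝ, Z = ∑' k : Fin n → ℤ, latticeWeight k := ⟨_, rfl⟩
  have hM0 : 0 ≤ M := (norm_nonneg _).trans (hM 0)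
  have main : ∀ ε : ℝ, 0 < ε → ε ≤ 1 →
      θ / 2 * (multiplier n 1 k₀ ^ 2 * ‖m k₀‖ ^ 2) ≤ J.card * K * Z * ε ^ 2 := by
    intro ε hε hε1
    obtain ⟨U, hU⟩ : ∃ U : (Fin n → ℤ) → ℂ, ∀ k, U k = (multiplier n ε k : ℂ) * m k :=
      ⟨_, fun _ => rfl⟩
    have hUn : ∀ k, ‖U k‖ = multiplier n ε k * ‖m k‖ := fun k => by
      simp [hU, abs_of_pos (multiplier_pos hε k)]
    have hUM : ∀ k, ‖U k‖ ≤ M := fun k => by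
      rw [hUn]
      have := multiplier_le_one hε k
      have := multiplier_pos hε k
      have := hM k
      have := norm_nonneg (m k)
      nlinarith
    obtain ⟨G, hGd⟩ : ∃ G : (Fin n → ℤ) → ℝ, ∀ k, G k = freqSq k * ‖U k‖ ^ 2 :=
      ⟨_, fun _ => rfl⟩
    have hG0 : ∀ k, 0 ≤ G k := fun k => by
      rw [hGd]; exact mul_nonneg (freqSq_nonneg k) (sq_nonneg _)
    have hG : Summable G := by
      refine ((summable_latticeWeight n).mul_left (((ε ^ (n + 1)) ^ 2)⁻¹ * M ^ 2)).of_nonneg_of_le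
        hG0 fun k => ?_
      have h1 := freqSq_mul_multiplier_sq_le hε hε1 k
      have h2 : ‖m k‖ ^ 2 ≤ M ^ 2 := by gcongr; exact hM k
      calc G k = freqSq k * multiplier n ε k ^ 2 * ‖m k‖ ^ 2 := by
            simp only [hGd, hUn]; ring
        _ ≤ (((ε ^ (n + 1)) ^ 2)⁻¹ * latticeWeight k) * M ^ 2 := by
            gcongr
            exact mul_nonneg (by positivity) (latticeWeight_nonneg k)
        _ = _ := by ring
    have hGs : ∀ j, Summable fun k => G (k + j) := fun j =>
      (Equiv.addRight j).summable_iff.2 hG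
    have hGt : ∀ j, ∑' k, G (k + j) = ∑' k, G k := fun j => (Equiv.addRight j).tsum_eq G
    have hsG : ∀ k, (√(freqSq k) * ‖U k‖) ^ 2 = G k := fun k => by
      rw [mul_pow, Real.sq_sqrt (freqSq_nonneg k), hGd]
    have ht : ∀ j ∈ J, Summable fun k => ‖conj (U k) * β j k * U (k + j)‖ := by
      intro j hj
      refine (((hG.add (hGs j)).mul_left C)).of_nonneg_of_le (fun _ => norm_nonneg _) fun k => ?_
      simp only [norm_mul, RCLike.norm_conj]
      rw [← hsG, ← hsG]
      calc ‖U k‖ * ‖β j k‖ * ‖U (k + j)‖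
          ≤ ‖U k‖ * (C * (√(freqSq k) * √(freqSq (k + j)))) * ‖U (k + j)‖ := by
            gcongr; exact hβ j hj k
        _ = C * ((√(freqSq k) * ‖U k‖) * (√(freqSq (k + j)) * ‖U (k + j)‖)) := by ring
        _ ≤ _ := by
            gcongr
            nlinarith [sq_nonneg (√(freqSq k) * ‖U k‖ - √(freqSq (k + j)) * ‖U (k + j)‖),
              sq_nonneg (√(freqSq k) * ‖U k‖ + √(freqSq (k + j)) * ‖U (k + j)‖)]
    have hpt : ∀ k, ‖∑ j ∈ J, conj (U k) * β j k * U (k + j)‖ ≤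
        ∑ j ∈ J, (κ * G (k + j) + κ * G k + K * ε ^ 2 * latticeWeight k) := by
      intro k
      by_cases hk : k = 0
      · have hz : ∀ j ∈ J, β j k = 0 := fun j hj => by
          have := hβ j hj k
          rw [hk] at this ⊢
          simpa [freqSq] using this
        rw [Finset.sum_eq_zero fun j hj => by simp [hz j hj], norm_zero]
        refine Finset.sum_nonneg fun j _ => ?_
        have := hG0 (k + j)
        have := hG0 k
        have := latticeWeight_nonneg k
        positivity
      have hcancel : ∑ j ∈ J, ((multiplier n ε k / multiplier n ε (k + j) : ℝ) : ℂ) *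
          (conj (U k) * β j k * U (k + j)) = 0 := by
        have : ∀ j ∈ J, ((multiplier n ε k / multiplier n ε (k + j) : ℝ) : ℂ) *
          (conj (U k) * β j k * U (k + j)) =
            (conj (U k) * multiplier n ε k) * (β j k * m (k + j)) := fun j _ => by
          have h0 : ((multiplier n ε (k + j) : ℝ) : ℂ) ≠ 0 := by
            exact_mod_cast (multiplier_pos hε (k + j)).ne'
          simp only [hU]
          push_cast
          field_simp
        rw [Finset.sum_congr rfl this, ← Finset.mul_sum, heq, mul_zero]
      rw [← sub_zero (∑ j ∈ J, conj (U k) * β j k * U (k + j)), ← hcancel,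
        ← Finset.sum_sub_distrib]
      refine (norm_sum_le _ _).trans (Finset.sum_le_sum fun j hj => ?_)
      obtain ⟨τ, hτ⟩ : ∃ τ : ℝ, τ = ε * freqSq k / (1 + ε * freqSq k) := ⟨_, rfl⟩
      have hq := freqSq_nonneg k
      have hεq : 0 ≤ ε * freqSq k := by positivity
      have hrat := multiplier_ratio hD0 hε hk (hD j hj)
      rw [← hτ] at hrat
      have hnorm : ‖conj (U k) * β j k * U (k + j) -
          ((multiplier n ε k / multiplier n ε (k + j) : ℝ) : ℂ) *
            (conj (U k) * β j k * U (k + j))‖ =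
          |1 - multiplier n ε k / multiplier n ε (k + j)| *
            (‖U k‖ * ‖β j k‖ * ‖U (k + j)‖) := by
        rw [← one_sub_mul, ← Complex.ofReal_one, ← Complex.ofReal_sub]
        simp only [norm_mul, RCLike.norm_conj, Complex.norm_real, Real.norm_eq_abs]
      rw [hnorm]
      have hstep : |1 - multiplier n ε k / multiplier n ε (k + j)| *
            (‖U k‖ * ‖β j k‖ * ‖U (k + j)‖) ≤
          E * (τ * ‖U k‖) * (√(freqSq (k + j)) * ‖U (k + j)‖) := by
        calc _ ≤ |1 - multiplier n ε k / multiplier n ε (k + j)| *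
              (‖U k‖ * (C * (√(freqSq k) * √(freqSq (k + j)))) * ‖U (k + j)‖) := by
              gcongr; exact hβ j hj k
          _ = (|1 - multiplier n ε k / multiplier n ε (k + j)| * √(freqSq k)) *
              (C * ‖U k‖ * (√(freqSq (k + j)) * ‖U (k + j)‖)) := by ring
          _ ≤ (D * (n + 1 : ℕ) * (1 + D) ^ n * τ) *
              (C * ‖U k‖ * (√(freqSq (k + j)) * ‖U (k + j)‖)) := by gcongr
          _ = _ := by rw [hE]; ring
      have hab := absorb_bound (E := E) (M := M) (x := √(freqSq (k + j)) * ‖U (k + j)‖)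
        hκ0 hq (τ := τ) (by rw [hτ]; positivity)
        (by rw [hτ, div_le_one (by positivity)]; linarith)
        (ε := ε) (by rw [hτ]; exact div_le_self hεq (by linarith)) (norm_nonneg (U k)) (hUM k) hR
      rw [hsG, ← hGd] at hab
      refine hstep.trans (hab.trans ?_)
      gcongr
      split_ifs with hqR
      · have h1 : 1 ≤ (1 + R) ^ n * latticeWeight k := by
          have h2 := inv_one_add_freqSq_pow_le k
          have h3 : (1 + freqSq k) ^ n ≤ (1 + R) ^ n := by gcongr
          have h4 : 0 < (1 + freqSq k) ^ n := by positivity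
          calc 1 = (1 + freqSq k) ^ n * ((1 + freqSq k) ^ n)⁻¹ := by field_simp
            _ ≤ _ := by gcongr
        calc κ * R ^ 3 * M ^ 2 * ε ^ 2 = κ * R ^ 3 * M ^ 2 * ε ^ 2 * 1 := by ring
          _ ≤ κ * R ^ 3 * M ^ 2 * ε ^ 2 * ((1 + R) ^ n * latticeWeight k) := by gcongr
          _ = _ := by rw [hK]; ring
      · have := latticeWeight_nonneg k
        positivity
    have hsum : HasSum (fun k => ∑ j ∈ J, (κ * G (k + j) + κ * G k + K * ε ^ 2 * latticeWeight k))
        (∑ _j ∈ J, (κ * ∑' k, G k + κ * ∑' k, G k + K * ε ^ 2 * Z)) := by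
      refine hasSum_sum fun j _ => ?_
      refine (HasSum.add ?_ (hG.hasSum.mul_left κ)).add
        (hZ ▸ (summable_latticeWeight n).hasSum.mul_left _)
      rw [← hGt j]
      exact (hGs j).hasSum.mul_left κ
    have hfin := (coercive_tsum hcoer ((funext hGd : G = _) ▸ hG) ht).trans
      (tsum_of_norm_bounded hsum hpt)
    simp only [← hGd] at hfin
    rw [Finset.sum_const, nsmul_eq_mul] at hfin
    have hGk : multiplier n 1 k₀ ^ 2 * ‖m k₀‖ ^ 2 ≤ ∑' k, G k := by
      refine le_trans ?_ (hG.le_tsum k₀ fun k _ => hG0 k)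
      rw [hGd, hUn]
      have h1 := one_le_freqSq hk₀
      have h2 : multiplier n 1 k₀ ≤ multiplier n ε k₀ := by
        have := freqSq_nonneg k₀
        unfold multiplier
        apply inv_anti₀ (by positivity)
        gcongr
      have h3 := multiplier_pos one_pos k₀
      calc multiplier n 1 k₀ ^ 2 * ‖m k₀‖ ^ 2 = 1 * (multiplier n 1 k₀ * ‖m k₀‖) ^ 2 := by ring
        _ ≤ _ := by gcongr
    have hcard : (J.card : ℝ) * (2 * κ) ≤ θ / 2 := by
      rw [hκ]
      have : (0 : ℝ) ≤ J.card := by positivity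
      have h : (J.card : ℝ) * (2 * (θ / (4 * (J.card + 1)))) =
        θ / 2 * (J.card / (J.card + 1)) := by field_simp; ring
      rw [h]
      have : (J.card : ℝ) / (J.card + 1) ≤ 1 := by rw [div_le_one (by positivity)]; linarith
      nlinarith
    have hS0 : 0 ≤ ∑' k, G k := tsum_nonneg hG0
    have h5 : θ / 2 * ∑' k, G k ≤ J.card * K * Z * ε ^ 2 := by
      have hfin' : θ * ∑' k, G k ≤ J.card * (κ * ∑' k, G k + κ * ∑' k, G k + K * ε ^ 2 * Z) :=
        hfin
      nlinarith [mul_le_mul_of_nonneg_right hcard hS0]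
    exact (mul_le_mul_of_nonneg_left hGk (by positivity)).trans h5
  have hlim : Tendsto (fun ε : ℝ => J.card * K * Z * ε ^ 2) (𝓝[>] 0) (𝓝 0) := by
    have : Continuous fun ε : ℝ => J.card * K * Z * ε ^ 2 := by fun_prop
    simpa using (this.tendsto 0).mono_left nhdsWithin_le_nhds
  have hle : θ / 2 * (multiplier n 1 k₀ ^ 2 * ‖m k₀‖ ^ 2) ≤ 0 := by
    refine ge_of_tendsto hlim ?_
    filter_upwards [Ioc_mem_nhdsGT (zero_lt_one (α := ℝ))] with ε hε
    exact main ε hε.1 hε.2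
  have hη := multiplier_pos one_pos k₀
  by_contra hne
  have : 0 < ‖m k₀‖ := norm_pos_iff.2 hne
  have : 0 < θ / 2 * (multiplier n 1 k₀ ^ 2 * ‖m k₀‖ ^ 2) := by positivity
  linarith

lemma measurableSet_box (n : ℕ) : MeasurableSet (box n) :=
  MeasurableSet.univ_pi fun _ => measurableSet_Ico

lemma volume_box (n : ℕ) : volume (box n) = 1 := by
  simp [box, volume_pi_pi]

lemma box_ae_eq_Icc (n : ℕ) : box n =ᵐ[volume] Set.Icc (0 : Fin n → ℝ) 1 := by
  have := Measure.univ_pi_Ico_ae_eq_Icc (μ := fun _ : Fin n => (volume : Measure ℝ)) (f := 0)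
    (g := 1)
  simp only [Pi.zero_apply, Pi.one_apply] at this
  exact this

lemma box_subset_Icc (n : ℕ) : box n ⊆ Set.Icc (0 : Fin n → ℝ) 1 := fun _ hx =>
  ⟨fun i => (hx i trivial).1, fun i => (hx i trivial).2.le⟩

instance isFiniteMeasure_restrict_box (n : ℕ) :
    IsFiniteMeasure ((volume : Measure (Fin n → ℝ)).restrict (box n)) :=
  ⟨by simp [volume_box]⟩

lemma exists_add_mem_box {n : ℕ} (x : Fin n → ℝ) :
    ∃ m : Fin n → ℤ, (x + fun i => (m i : ℝ)) ∈ box n := by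
  refine ⟨fun i => -⌊x i⌋, fun i _ => ?_⟩
  have h1 := Int.floor_le (x i)
  have h2 := Int.lt_floor_add_one (x i)
  simp only [Pi.add_apply, Int.cast_neg, Set.mem_Ico]
  constructor <;> linarith

lemma ZPeriodic.vadd {n : ℕ} {E : Type*} {f : (Fin n → ℝ) → E} (hf : ZPeriodic f)
    (g : (Submodule.span ℤ (Set.range (Pi.basisFun ℝ (Fin n)))).toAddSubgroup) (x : Fin n → ℝ) :
    f (g +ᵥ x) = f x := by
  have hg := ((Pi.basisFun ℝ (Fin n)).mem_span_iff_repr_mem ℤ (g : Fin n → ℝ)).1 g.2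
  choose m hm using hg
  have : g +ᵥ x = x + fun i => (m i : ℝ) := by
    rw [AddSubgroup.vadd_def, vadd_eq_add, add_comm]
    congr 1
    ext i
    simpa using (hm i).symm
  rw [this, hf]

instance countable_basisFun_lattice (n : ℕ) :
    Countable (Submodule.span ℤ (Set.range (Pi.basisFun ℝ (Fin n)))).toAddSubgroup :=
  inferInstanceAs (Countable (Submodule.span ℤ (Set.range (Pi.basisFun ℝ (Fin n)))))

lemma isAddFundamentalDomain_box (n : ℕ) (a : Fin n → ℝ) :
    IsAddFundamentalDomain (Submodule.span ℤ (Set.range (Pi.basisFun ℝ (Fin n)))).toAddSubgroup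
      ((fun x => x - a) ⁻¹' box n) (volume : Measure (Fin n → ℝ)) := by
  have h := ZSpan.isAddFundamentalDomain' (Pi.basisFun ℝ (Fin n)) volume
  rw [ZSpan.fundamentalDomain_pi_basisFun] at h
  refine h.preimage_of_equiv
    (measurePreserving_sub_right volume a).quasiMeasurePreserving
    (e := Equiv.refl _) (Equiv.refl _).bijective fun g x => ?_
  simp [AddSubgroup.vadd_def, add_sub_assoc]

lemma ZPeriodic.integrableOn_translate {n : ℕ} {E : Type*} [NormedAddCommGroup E]
    {f : (Fin n → ℝ) → E} (hf : ZPeriodic f) (hi : IntegrableOn f (box n)) (a : Fin n → ℝ) :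
    IntegrableOn f ((fun x => x - a) ⁻¹' box n) := by
  refine ((isAddFundamentalDomain_box n a).integrableOn_iff (isAddFundamentalDomain_box n 0)
    hf.vadd).2 (by simpa using hi)

lemma ZPeriodic.integrableOn_comp_add {n : ℕ} {E : Type*} [NormedAddCommGroup E]
    {f : (Fin n → ℝ) → E} (hf : ZPeriodic f) (hi : IntegrableOn f (box n)) (a : Fin n → ℝ) :
    IntegrableOn (fun x => f (x + a)) (box n) := by
  have h := ((measurePreserving_add_right volume a).integrableOn_comp_preimage
    (measurableEmbedding_addRight a)).2 (hf.integrableOn_translate hi a)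
  simpa [Set.preimage_preimage, Function.comp_def] using h

lemma ZPeriodic.setIntegral_comp_add {n : ℕ} {E : Type*} [NormedAddCommGroup E] [NormedSpace ℝ E]
    {f : (Fin n → ℝ) → E} (hf : ZPeriodic f) (a : Fin n → ℝ) :
    ∫ x in box n, f (x + a) = ∫ x in box n, f x := by
  have h := (measurePreserving_add_right volume a).setIntegral_preimage_emb
    (measurableEmbedding_addRight a) f ((fun x => x - a) ⁻¹' box n)
  have h2 := (isAddFundamentalDomain_box n a).setIntegral_eq (isAddFundamentalDomain_box n 0)
    (f := f) hf.vadd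
  simp only [Set.preimage_preimage, add_sub_cancel_right, sub_zero, Set.preimage_id'] at h h2
  exact h.trans h2

lemma ZPeriodic.locallyIntegrable {n : ℕ} {E : Type*} [NormedAddCommGroup E]
    {f : (Fin n → ℝ) → E} (hf : ZPeriodic f) (hi : IntegrableOn f (box n)) :
    LocallyIntegrable f := by
  intro x
  refine ⟨_, ?_, hf.integrableOn_translate hi (fun i => x i - 1 / 2)⟩
  have hopen : IsOpen ((fun y : Fin n → ℝ => y - fun i => x i - 1 / 2) ⁻¹'
      (Set.univ.pi fun _ => Set.Ioo (0 : ℝ) 1)) :=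
    (isOpen_set_pi Set.finite_univ fun _ _ => isOpen_Ioo).preimage (by fun_prop)
  refine mem_of_superset (hopen.mem_nhds ?_) (Set.preimage_mono
    (Set.pi_mono fun _ _ => Set.Ioo_subset_Ico_self))
  intro i _
  norm_num

lemma Continuous.integrableOn_box {n : ℕ} {E : Type*} [NormedAddCommGroup E]
    {f : (Fin n → ℝ) → E} (hf : Continuous f) : IntegrableOn f (box n) :=
  (hf.continuousOn.integrableOn_compact isCompact_Icc).mono_set (box_subset_Icc n)

lemma second_derivative_test {φ ψ : ℝ → ℝ} {d : ℝ} (hφ : ∀ t, HasDerivAt φ (ψ t) t)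
    (hψ : HasDerivAt ψ d 0) (hmin : ∀ t, φ 0 ≤ φ t) : ψ 0 = 0 ∧ 0 ≤ d := by
  have h0 : ψ 0 = 0 := by
    have : IsLocalMin φ 0 := Eventually.of_forall hmin
    exact this.hasDerivAt_eq_zero (hφ 0)
  refine ⟨h0, ?_⟩
  by_contra! hd
  have hs := hψ.tendsto_slope_zero_right.eventually (gt_mem_nhds hd)
  rw [eventually_nhdsWithin_iff, Metric.eventually_nhds_iff] at hs
  obtain ⟨δ, hδ, hs⟩ := hs
  obtain ⟨ξ, hξ, hξ'⟩ := exists_hasDerivAt_eq_slope φ ψ (half_pos hδ)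
    (fun t _ => (hφ t).continuousAt.continuousWithinAt) (fun t _ => hφ t)
  have h1 := @hs ξ (by rw [Real.dist_eq, sub_zero, abs_of_pos hξ.1]; linarith [hξ.2]) hξ.1
  simp only [zero_add, h0, sub_zero, smul_eq_mul] at h1
  have h2 : ψ ξ < 0 := by
    have h3 : 0 < ξ := hξ.1
    have : ψ ξ = ξ * (ξ⁻¹ * ψ ξ) := by field_simp
    rw [this]; exact mul_neg_of_pos_of_neg h3 h1
  rw [hξ'] at h2
  have h3 := hmin (δ / 2)
  have : 0 ≤ (φ (δ / 2) - φ 0) / (δ / 2 - 0) := div_nonneg (by linarith) (by linarith)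
  linarith

lemma Matrix.PosDef.exists_pos_mul_norm_sq_le {n : ℕ} {S : Matrix (Fin n) (Fin n) ℝ}
    (hS : S.PosDef) : ∃ c : ℝ, 0 < c ∧ ∀ x : Fin n → ℝ, c * ‖x‖ ^ 2 ≤ x ⬝ᵥ S *ᵥ x := by
  have hcont : Continuous fun x : Fin n → ℝ => x ⬝ᵥ S *ᵥ x := by fun_prop
  have key : ∃ c : ℝ, 0 < c ∧ ∀ x ∈ Metric.sphere (0 : Fin n → ℝ) 1, c ≤ x ⬝ᵥ S *ᵥ x := by
    rcases (Metric.sphere (0 : Fin n → ℝ) 1).eq_empty_or_nonempty with h | h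
    · exact ⟨1, one_pos, by simp [h]⟩
    obtain ⟨y, hy, hmin⟩ := (isCompact_sphere (0 : Fin n → ℝ) 1).exists_isMinOn h
      hcont.continuousOn
    have hy0 : y ≠ 0 := by
      rintro rfl
      simp at hy
    exact ⟨_, by simpa using hS.dotProduct_mulVec_pos hy0, fun x hx => hmin hx⟩
  obtain ⟨c, hc, hle⟩ := key
  refine ⟨c, hc, fun x => ?_⟩
  by_cases hx : x = 0
  · simp [hx]
  have hn : 0 < ‖x‖ := norm_pos_iff.2 hx
  have h1 := hle (‖x‖⁻¹ • x) (by simp [norm_smul, hn.ne'])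
  rw [Matrix.mulVec_smul, smul_dotProduct, dotProduct_smul, smul_eq_mul, smul_eq_mul] at h1
  calc c * ‖x‖ ^ 2 ≤ (‖x‖⁻¹ * (‖x‖⁻¹ * (x ⬝ᵥ S *ᵥ x))) * ‖x‖ ^ 2 := by gcongr
    _ = _ := by field_simp

lemma abs_dotProduct_le_sum_mul_norm {n : ℕ} (a x : Fin n → ℝ) :
    |a ⬝ᵥ x| ≤ (∑ i, |a i|) * ‖x‖ := by
  rw [dotProduct, Finset.sum_mul]
  refine (Finset.abs_sum_le_sum_abs _ _).trans (Finset.sum_le_sum fun i _ => ?_)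
  rw [abs_mul]
  gcongr
  exact norm_le_pi_norm x i

lemma ZPeriodic.exists_bound {n : ℕ} {E : Type*} [NormedAddCommGroup E] {u : (Fin n → ℝ) → E}
    (hu : ZPeriodic u) (hc : Continuous u) : ∃ M : ℝ, ∀ x, ‖u x‖ ≤ M := by
  obtain ⟨M, hM⟩ := (isCompact_Icc (a := (0 : Fin n → ℝ)) (b := 1)).exists_bound_of_continuousOn
    hc.continuousOn
  refine ⟨M, fun x => ?_⟩
  obtain ⟨m, hm⟩ := exists_add_mem_box x
  rw [← hu x m]
  exact hM _ (box_subset_Icc n hm)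

lemma exists_forall_quadratic_add_le {n : ℕ} {S : Matrix (Fin n) (Fin n) ℝ} (hS : S.PosDef)
    {u : (Fin n → ℝ) → ℝ} (hu : ZPeriodic u) (hc : Continuous u) (a : Fin n → ℝ) :
    ∃ x, ∀ y, x ⬝ᵥ S *ᵥ x / 2 + u x - a ⬝ᵥ x ≤ y ⬝ᵥ S *ᵥ y / 2 + u y - a ⬝ᵥ y := by
  obtain ⟨c, hc0, hcS⟩ := hS.exists_pos_mul_norm_sq_le
  obtain ⟨M, hM⟩ := hu.exists_bound hc
  refine Continuous.exists_forall_le (f := fun x => x ⬝ᵥ S *ᵥ x / 2 + u x - a ⬝ᵥ x)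
    (by fun_prop) ?_
  have hlim : Tendsto (fun r : ℝ => r * (c / 2 * r - ∑ i, |a i|) + (-M)) atTop atTop := by
    refine tendsto_atTop_add_const_right _ _ ?_
    refine tendsto_id.atTop_mul_atTop₀ ?_
    exact tendsto_atTop_add_const_right _ _ (tendsto_id.const_mul_atTop (half_pos hc0))
  refine tendsto_atTop_mono (fun x => ?_)
    (hlim.comp (tendsto_norm_cocompact_atTop (E := Fin n → ℝ)))
  have h1 := hcS x
  have h2 := (abs_le.1 (hM x)).1
  have h3 := (abs_le.1 (abs_dotProduct_le_sum_mul_norm a x)).2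
  simp only [Function.comp_apply]
  nlinarith

lemma exists_preimage_gradient {n : ℕ} {S : Matrix (Fin n) (Fin n) ℝ} (hS : S.PosDef)
    {u : (Fin n → ℝ) → ℝ} {g : (Fin n → ℝ) → Fin n → ℝ}
    {h : (Fin n → ℝ) → Matrix (Fin n) (Fin n) ℝ}
    (hu : ZPeriodic u) (huc : Continuous u) (hsymm : ∀ x, (h x).IsHermitian)
    (hud : ∀ x v, HasDerivAt (fun t : ℝ => u (x + t • v)) (g x ⬝ᵥ v) 0)
    (hgd : ∀ x, HasFDerivAt g (Matrix.toLin' (h x)).toContinuousLinearMap x) (p : Fin n → ℝ) :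
    ∃ x, x + S⁻¹ *ᵥ g x = p ∧ (S + h x).PosSemidef := by
  obtain ⟨x, hx⟩ := exists_forall_quadratic_add_le hS hu huc (S *ᵥ p)
  have hST : ∀ v w : Fin n → ℝ, v ⬝ᵥ S *ᵥ w = S *ᵥ v ⬝ᵥ w := fun v w => by
    have : Sᵀ = S := by simpa [Matrix.IsSymm] using hS.isHermitian
    rw [Matrix.dotProduct_mulVec, ← Matrix.mulVec_transpose, this]
  have hder : ∀ v : Fin n → ℝ, (S *ᵥ x + g x - S *ᵥ p) ⬝ᵥ v = 0 ∧
      0 ≤ v ⬝ᵥ (S + h x) *ᵥ v := by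
    intro v
    have hu' : ∀ t : ℝ, HasDerivAt (fun t : ℝ => u (x + t • v)) (g (x + t • v) ⬝ᵥ v) t := by
      intro t
      have h1 := hud (x + t • v) v
      have h2 : HasDerivAt (fun s : ℝ => s - t) 1 t := (hasDerivAt_id t).sub_const t
      have h3 := HasDerivAt.comp_of_eq t h1 h2 (by simp)
      refine (h3.congr_deriv (by simp)).congr_of_eventuallyEq (Eventually.of_forall fun s => ?_)
      simp only [Function.comp_apply]
      congr 1
      module
    have hg' : HasDerivAt (fun t : ℝ => g (x + t • v) ⬝ᵥ v) (h x *ᵥ v ⬝ᵥ v) 0 := by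
      have h1 : HasDerivAt (fun t : ℝ => x + t • v) v 0 := by
        simpa using ((hasDerivAt_id (0 : ℝ)).smul_const v).const_add x
      have h2 : HasDerivAt (fun t : ℝ => g (x + t • v)) (h x *ᵥ v) 0 := by
        have h0 : HasFDerivAt g (Matrix.toLin' (h x)).toContinuousLinearMap
          (x + (0 : ℝ) • v) := by simpa using hgd x
        have := h0.comp_hasDerivAt (0 : ℝ) h1
        simpa [Function.comp_def] using this
      unfold dotProduct
      exact HasDerivAt.fun_sum fun i _ => ((hasDerivAt_pi.1 h2) i).mul_const (v i)
    have hquad : ∀ t : ℝ, (x + t • v) ⬝ᵥ S *ᵥ (x + t • v) / 2 - (S *ᵥ p) ⬝ᵥ (x + t • v) =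
        (x ⬝ᵥ S *ᵥ x / 2 - (S *ᵥ p) ⬝ᵥ x) + t * (S *ᵥ x ⬝ᵥ v - S *ᵥ p ⬝ᵥ v) +
          t ^ 2 * ((v ⬝ᵥ S *ᵥ v) / 2) := by
      intro t
      simp only [Matrix.mulVec_add, Matrix.mulVec_smul, add_dotProduct, dotProduct_add,
        smul_dotProduct, dotProduct_smul, smul_eq_mul, hST x v, hST v x]
      rw [dotProduct_comm (S *ᵥ v) x, hST x v]
      ring
    have hφ : ∀ t : ℝ, HasDerivAt (fun t : ℝ => (x + t • v) ⬝ᵥ S *ᵥ (x + t • v) / 2 +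
        u (x + t • v) - (S *ᵥ p) ⬝ᵥ (x + t • v))
        ((S *ᵥ x ⬝ᵥ v - S *ᵥ p ⬝ᵥ v) + t * (v ⬝ᵥ S *ᵥ v) + g (x + t • v) ⬝ᵥ v) t := by
      intro t
      have h1 : HasDerivAt (fun t : ℝ => (x ⬝ᵥ S *ᵥ x / 2 - (S *ᵥ p) ⬝ᵥ x) +
          t * (S *ᵥ x ⬝ᵥ v - S *ᵥ p ⬝ᵥ v) + t ^ 2 * ((v ⬝ᵥ S *ᵥ v) / 2))
          ((S *ᵥ x ⬝ᵥ v - S *ᵥ p ⬝ᵥ v) + t * (v ⬝ᵥ S *ᵥ v)) t := by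
        have := (((hasDerivAt_id t).mul_const (S *ᵥ x ⬝ᵥ v - S *ᵥ p ⬝ᵥ v)).const_add
          (x ⬝ᵥ S *ᵥ x / 2 - (S *ᵥ p) ⬝ᵥ x)).add
          ((hasDerivAt_pow 2 t).mul_const ((v ⬝ᵥ S *ᵥ v) / 2))
        refine this.congr_deriv ?_
        simp
        ring
      refine (h1.add (hu' t)).congr_of_eventuallyEq (Eventually.of_forall fun s => ?_)
      simp only [Pi.add_apply]
      rw [← hquad]
      ring
    have hψ : HasDerivAt (fun t : ℝ => (S *ᵥ x ⬝ᵥ v - S *ᵥ p ⬝ᵥ v) + t * (v ⬝ᵥ S *ᵥ v) +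
        g (x + t • v) ⬝ᵥ v) (v ⬝ᵥ S *ᵥ v + h x *ᵥ v ⬝ᵥ v) 0 := by
      have := (((hasDerivAt_id (0 : ℝ)).mul_const (v ⬝ᵥ S *ᵥ v)).const_add
        (S *ᵥ x ⬝ᵥ v - S *ᵥ p ⬝ᵥ v)).add hg'
      exact this.congr_deriv (by simp)
    obtain ⟨h1, h2⟩ := second_derivative_test hφ hψ (fun t => by simpa using hx (x + t • v))
    constructor
    · simp only [zero_mul, add_zero, zero_smul] at h1
      rw [sub_dotProduct, add_dotProduct]
      linarith
    · rw [Matrix.add_mulVec, dotProduct_add, dotProduct_comm v (h x *ᵥ v)]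
      exact h2
  refine ⟨x, ?_, .of_dotProduct_mulVec_nonneg (hS.isHermitian.add (hsymm x)) fun v => ?_⟩
  · have h1 : S *ᵥ x + g x - S *ᵥ p = 0 := dotProduct_eq_zero _ fun v => (hder v).1
    have h2 : g x = S *ᵥ (p - x) := by
      rw [Matrix.mulVec_sub]
      linear_combination (exp := 1) h1
    have hdet : IsUnit S.det := hS.det_pos.ne'.isUnit
    rw [h2, Matrix.mulVec_mulVec, Matrix.nonsing_inv_mul _ hdet, Matrix.one_mulVec]
    abel
  · simpa using (hder v).2

lemma intCast_mem_lattice {n : ℕ} (m : Fin n → ℤ) : (fun i => (m i : ℝ)) ∈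
    (Submodule.span ℤ (Set.range (Pi.basisFun ℝ (Fin n)))).toAddSubgroup := by
  refine ((Pi.basisFun ℝ (Fin n)).mem_span_iff_repr_mem ℤ _).2 fun i => ⟨m i, ?_⟩
  simp

/-- A set whose integer translates cover the unit box has measure at least one. -/
lemma one_le_volume_of_cover {n : ℕ} {T : Set (Fin n → ℝ)}
    (hT : ∀ p ∈ box n, ∃ m : Fin n → ℤ, (p + fun i => (m i : ℝ)) ∈ T) : 1 ≤ volume T := by
  have h := (isAddFundamentalDomain_box n 0).measure_eq_tsum T
  simp only [sub_zero, Set.preimage_id'] at h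
  rw [h, ← volume_box n]
  refine le_trans (measure_mono fun p hp => ?_) (measure_iUnion_le _)
  obtain ⟨m, hm⟩ := hT p hp
  refine Set.mem_iUnion.2 ⟨⟨_, intCast_mem_lattice (-m)⟩, ⟨_, hm, ?_⟩, hp⟩
  ext i
  simp [AddSubgroup.vadd_def]

lemma isClosed_setOf_posSemidef (n : ℕ) :
    IsClosed {M : Matrix (Fin n) (Fin n) ℝ | M.PosSemidef} := by
  simp only [Matrix.posSemidef_iff_dotProduct_mulVec, Set.ofPred_and, Set.ofPred_forall]
  refine IsClosed.inter ?_ (isClosed_iInter fun x => ?_)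
  · exact isClosed_eq (by fun_prop) continuous_id
  · exact isClosed_le continuous_const (by fun_prop)

/-- The Alexandrov-Bakelman-Pucci estimate on the torus for a quadratic polynomial plus a
periodic function. -/
lemma det_le_setIntegral_det {n : ℕ} {S : Matrix (Fin n) (Fin n) ℝ} (hS : S.PosDef)
    {u : (Fin n → ℝ) → ℝ} {g : (Fin n → ℝ) → Fin n → ℝ}
    {h : (Fin n → ℝ) → Matrix (Fin n) (Fin n) ℝ}
    (hu : ZPeriodic u) (hg : ZPeriodic g) (hh : ZPeriodic h)
    (huc : Continuous u) (hhc : Continuous h) (hsymm : ∀ x, (h x).IsHermitian)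
    (hud : ∀ x v, HasDerivAt (fun t : ℝ => u (x + t • v)) (g x ⬝ᵥ v) 0)
    (hgd : ∀ x, HasFDerivAt g (Matrix.toLin' (h x)).toContinuousLinearMap x) :
    ∃ E : Set (Fin n → ℝ), MeasurableSet E ∧ E ⊆ box n ∧ (∀ x ∈ E, (S + h x).PosSemidef) ∧
      S.det ≤ ∫ x in E, (S + h x).det := by
  have hdet : IsUnit S.det := hS.det_pos.ne'.isUnit
  let E : Set (Fin n → ℝ) := box n ∩ (fun x => S + h x) ⁻¹' {M | M.PosSemidef}
  have hE : MeasurableSet E := (measurableSet_box n).inter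
    ((isClosed_setOf_posSemidef n).preimage (by fun_prop)).measurableSet
  refine ⟨E, hE, Set.inter_subset_left, fun x hx => hx.2, ?_⟩
  let T : (Fin n → ℝ) → Fin n → ℝ := fun x => x + S⁻¹ *ᵥ g x
  let T' : (Fin n → ℝ) → (Fin n → ℝ) →L[ℝ] Fin n → ℝ := fun x =>
    (Matrix.toLin' (S⁻¹ * (S + h x))).toContinuousLinearMap
  have hTd : ∀ x, HasFDerivAt T (T' x) x := fun x => by
    have h1 : HasFDerivAt (fun y => (Matrix.toLin' S⁻¹).toContinuousLinearMap (g y))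
        ((Matrix.toLin' S⁻¹).toContinuousLinearMap ∘L
          (Matrix.toLin' (h x)).toContinuousLinearMap) x :=
      (Matrix.toLin' S⁻¹).toContinuousLinearMap.hasFDerivAt.comp x (hgd x)
    refine ((hasFDerivAt_id x).add h1).congr_fderiv ?_
    ext1 v
    simp [T', Matrix.mul_add, Matrix.nonsing_inv_mul _ hdet,
      Matrix.mulVec_mulVec]
  have hcover : 1 ≤ volume (T '' E) := by
    refine one_le_volume_of_cover fun p _ => ?_
    obtain ⟨x, hx, hpsd⟩ := exists_preimage_gradient hS hu huc hsymm hud hgd p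
    obtain ⟨m, hm⟩ := exists_add_mem_box x
    refine ⟨m, _, ⟨hm, ?_⟩, ?_⟩
    · simpa [hh x m] using hpsd
    · simp only [T, hg x m]
      rw [← hx]
      abel
  have harea := hcover.trans (addHaar_image_le_lintegral_abs_det_fderiv volume hE
    fun x _ => (hTd x).hasFDerivWithinAt)
  have hcd : Continuous fun x => (S + h x).det := by fun_prop
  have h_int : IntegrableOn (fun x => (S + h x).det) E :=
    hcd.integrableOn_box.mono_set Set.inter_subset_left
  have hnn : ∀ x ∈ E, 0 ≤ (S + h x).det := fun x hx => Matrix.PosSemidef.det_nonneg hx.2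
  have hTdet : ∀ x ∈ E, |(T' x).det| = S.det⁻¹ * (S + h x).det := fun x hx => by
    have : (T' x).det = S.det⁻¹ * (S + h x).det := by
      simp only [T', ContinuousLinearMap.det, LinearMap.coe_toContinuousLinearMap,
        LinearMap.det_toLin', Matrix.det_mul, Matrix.det_nonsing_inv, Ring.inverse_eq_inv']
    rw [this, abs_of_nonneg]
    exact mul_nonneg (inv_nonneg.2 hS.det_pos.le) (hnn x hx)
  rw [setLIntegral_congr_fun hE (fun x hx => by rw [hTdet x hx]),
    ← ofReal_integral_eq_lintegral_ofReal (h_int.const_mul _), ENNReal.one_le_ofReal,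
    integral_const_mul] at harea
  · have := mul_le_mul_of_nonneg_left harea hS.det_pos.le
    rwa [mul_one, ← mul_assoc, mul_inv_cancel₀ hS.det_pos.ne', one_mul] at this
  · filter_upwards [ae_restrict_mem hE] with x hx
    exact mul_nonneg (inv_nonneg.2 hS.det_pos.le) (hnn x hx)

lemma prod_le_sum_div_pow {n : ℕ} (hn : n ≠ 0) {z : Fin n → ℝ} (hz : ∀ i, 0 ≤ z i) :
    ∏ i, z i ≤ ((∑ i, z i) / n) ^ n := by
  have hn' : (0 : ℝ) < n := by positivity
  have h := Real.geom_mean_le_arith_mean_weighted Finset.univ (fun _ => (1 / n : ℝ)) z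
    (fun _ _ => by positivity) (by simp [hn'.ne']) (fun i _ => hz i)
  rw [← Finset.mul_sum, one_div_mul_eq_div,
    Real.finsetProd_rpow _ _ (fun i _ => hz i)] at h
  have h0 : 0 ≤ ∏ i, z i := Finset.prod_nonneg fun i _ => hz i
  calc ∏ i, z i = ((∏ i, z i) ^ (1 / n : ℝ)) ^ n := by
        rw [← Real.rpow_natCast, ← Real.rpow_mul h0]; simp [hn]
    _ ≤ _ := by gcongr

lemma Matrix.PosSemidef.det_le_trace_div_pow {n : ℕ} (hn : n ≠ 0) {K : Matrix (Fin n) (Fin n) ℝ}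
    (hK : K.PosSemidef) : K.det ≤ (K.trace / n) ^ n := by
  rw [hK.isHermitian.det_eq_prod_eigenvalues, hK.isHermitian.trace_eq_sum_eigenvalues]
  exact prod_le_sum_div_pow hn hK.eigenvalues_nonneg

open scoped MatrixOrder in
lemma Matrix.PosSemidef.exists_eq_conjTranspose_mul_self {n : ℕ} {A : Matrix (Fin n) (Fin n) ℝ}
    (hA : A.PosSemidef) : ∃ B : Matrix (Fin n) (Fin n) ℝ, A = Bᴴ * B :=
  CStarAlgebra.nonneg_iff_eq_star_mul_self.mp hA.nonneg

lemma Matrix.PosSemidef.det_mul_det_le {n : ℕ} (hn : n ≠ 0) {A H : Matrix (Fin n) (Fin n) ℝ}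
    (hA : A.PosSemidef) (hH : H.PosSemidef) : A.det * H.det ≤ ((A * H).trace / n) ^ n := by
  obtain ⟨B, rfl⟩ := hA.exists_eq_conjTranspose_mul_self
  have h := (hH.mul_mul_conjTranspose_same B).det_le_trace_div_pow hn
  rw [Matrix.trace_mul_comm, ← Matrix.mul_assoc] at h
  refine le_trans (le_of_eq ?_) h
  simp only [Matrix.det_mul]
  ring

lemma Matrix.PosSemidef.trace_mul_nonneg {n : ℕ} {A H : Matrix (Fin n) (Fin n) ℝ}
    (hA : A.PosSemidef) (hH : H.PosSemidef) : 0 ≤ (A * H).trace := by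
  obtain ⟨B, rfl⟩ := hA.exists_eq_conjTranspose_mul_self
  have h := (hH.mul_mul_conjTranspose_same B).trace_nonneg
  rwa [Matrix.trace_mul_comm, ← Matrix.mul_assoc] at h

/-- The phase `2π k·x` as a continuous linear functional of `x`. -/
def phase {n : ℕ} (k : Fin n → ℤ) : (Fin n → ℝ) →L[ℝ] ℝ :=
  ∑ i, (2 * Real.pi * k i) • ContinuousLinearMap.proj i

lemma phase_apply {n : ℕ} (k : Fin n → ℤ) (x : Fin n → ℝ) :
    phase k x = ∑ i, 2 * Real.pi * k i * x i := by
  simp [phase]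

/-- The character `exp(2πi k·x)`. -/
def expi {n : ℕ} (k : Fin n → ℤ) (x : Fin n → ℝ) : ℂ := Complex.exp (phase k x * Complex.I)

lemma expi_zero {n : ℕ} (x : Fin n → ℝ) : expi 0 x = 1 := by
  simp [expi, phase_apply]

lemma expi_add {n : ℕ} (j k : Fin n → ℤ) (x : Fin n → ℝ) :
    expi (j + k) x = expi j x * expi k x := by
  rw [expi, expi, expi, ← Complex.exp_add, ← add_mul, ← Complex.ofReal_add]
  congr 3
  simp only [phase_apply, ← Finset.sum_add_distrib]
  refine Finset.sum_congr rfl fun i _ => ?_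
  push_cast [Pi.add_apply]
  ring

lemma expi_add_right {n : ℕ} (k : Fin n → ℤ) (x y : Fin n → ℝ) :
    expi k (x + y) = expi k x * expi k y := by
  rw [expi, expi, expi, ← Complex.exp_add, ← add_mul, ← Complex.ofReal_add, map_add]

lemma conj_expi {n : ℕ} (k : Fin n → ℤ) (x : Fin n → ℝ) : conj (expi k x) = expi (-k) x := by
  rw [expi, expi, ← Complex.exp_conj, map_mul, Complex.conj_I, Complex.conj_ofReal]
  congr 1
  have : phase (-k) x = -phase k x := by
    simp [phase_apply, Finset.sum_neg_distrib]
  rw [this]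
  push_cast
  ring

lemma expi_neg_right {n : ℕ} (k : Fin n → ℤ) (x : Fin n → ℝ) : expi k (-x) = expi (-k) x := by
  rw [expi, expi]
  congr 3
  simp [phase_apply, Finset.sum_neg_distrib]

lemma norm_expi {n : ℕ} (k : Fin n → ℤ) (x : Fin n → ℝ) : ‖expi k x‖ = 1 :=
  Complex.norm_exp_ofReal_mul_I _

lemma continuous_expi {n : ℕ} (k : Fin n → ℤ) : Continuous (expi k) := by
  unfold expi
  fun_prop

lemma expi_intCast {n : ℕ} (k m : Fin n → ℤ) : expi k (fun i => (m i : ℝ)) = 1 := by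
  rw [expi, Complex.exp_eq_one_iff]
  refine ⟨∑ i, k i * m i, ?_⟩
  rw [phase_apply]
  push_cast
  rw [Finset.sum_mul, Finset.sum_mul]
  exact Finset.sum_congr rfl fun i _ => by ring

lemma zPeriodic_expi {n : ℕ} (k : Fin n → ℤ) : ZPeriodic (expi k) := fun x m => by
  rw [expi_add_right, expi_intCast, mul_one]

lemma hasFDerivAt_expi {n : ℕ} (k : Fin n → ℤ) (x : Fin n → ℝ) :
    HasFDerivAt (expi k) ((expi k x * Complex.I) • (Complex.ofRealCLM ∘L phase k)) x := by
  have h1 : HasFDerivAt (fun y => (phase k y : ℂ)) (Complex.ofRealCLM ∘L phase k) x :=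
    (Complex.ofRealCLM ∘L phase k).hasFDerivAt
  refine (h1.mul_const Complex.I).cexp.congr_fderiv ?_
  ext v
  simp [expi]
  ring

lemma contDiff_expi {n : ℕ} (k : Fin n → ℤ) {N : WithTop ℕ∞} : ContDiff ℝ N (expi k) := by
  unfold expi
  exact ((Complex.ofRealCLM.contDiff.comp (phase k).contDiff).mul contDiff_const).cexp

lemma expi_eq_neg_one {n : ℕ} {k : Fin n → ℤ} {i : Fin n} (hi : k i ≠ 0) :
    expi k (Pi.single i (1 / (2 * (k i : ℝ)))) = -1 := by
  rw [expi, phase_apply, Finset.sum_eq_single i (by intro b _ hb; simp [hb]) (by simp),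
    Pi.single_eq_same]
  have : (k i : ℝ) ≠ 0 := by exact_mod_cast hi
  have h : 2 * Real.pi * k i * (1 / (2 * (k i : ℝ))) = Real.pi := by field_simp
  rw [h, Complex.exp_pi_mul_I]

lemma setIntegral_expi {n : ℕ} (k : Fin n → ℤ) :
    ∫ x in box n, expi k x = if k = 0 then 1 else 0 := by
  split_ifs with hk
  · simp [hk, expi_zero, Measure.real, volume_box]
  obtain ⟨i, hi⟩ : ∃ i, k i ≠ 0 := by
    by_contra! h
    exact hk (funext h)
  have h := (zPeriodic_expi k).setIntegral_comp_add (Pi.single i (1 / (2 * (k i : ℝ))))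
  simp only [expi_add_right, expi_eq_neg_one hi, mul_neg, mul_one] at h
  rw [integral_neg] at h
  linear_combination (-1 / 2 : ℂ) * h

/-- Parseval evaluation of a quadratic form in the trigonometric sums `∑ k_l U_k e^{-2πi k·x}`. -/
lemma setIntegral_quadratic_form {n : ℕ} {J : Finset (Fin n → ℤ)}
    {a : (Fin n → ℤ) → Matrix (Fin n) (Fin n) ℂ} {U : (Fin n → ℤ) → ℂ} {F : Finset (Fin n → ℤ)}
    (hU : ∀ k ∉ F, U k = 0) :
    ∫ x in box n, ∑ i, ∑ l, conj (∑ k ∈ F, k i * U k * expi (-k) x) *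
        (∑ j ∈ J, a j i l * expi j x) * ∑ k ∈ F, k l * U k * expi (-k) x =
      ∑ k ∈ F, ∑ j ∈ J, conj (U k) * (∑ i, ∑ l, k i * a j i l * (k + j) l) * U (k + j) := by
  have hexp : ∀ x : Fin n → ℝ, ∑ i, ∑ l, conj (∑ k ∈ F, k i * U k * expi (-k) x) *
        (∑ j ∈ J, a j i l * expi j x) * ∑ k ∈ F, k l * U k * expi (-k) x =
      ∑ k ∈ F, ∑ j ∈ J, ∑ k' ∈ F, (conj (U k) * (∑ i, ∑ l, k i * a j i l * k' l) * U k') *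
        expi (k + j - k') x := by
    intro x
    have he : ∀ k j k' : Fin n → ℤ, expi (k + j - k') x = conj (expi (-k) x) * expi j x *
        expi (-k') x := fun k j k' => by
      rw [conj_expi, neg_neg, sub_eq_add_neg, expi_add, expi_add]
    simp only [he, map_sum, Finset.sum_mul, Finset.mul_sum, map_mul, map_intCast]
    calc _ = ∑ i, ∑ l, ∑ k ∈ F, ∑ j ∈ J, ∑ k' ∈ F, (conj (U k) * (k i * a j i l * k' l) * U k') *
          (conj (expi (-k) x) * expi j x * expi (-k') x) := by
          refine Finset.sum_congr rfl fun i _ => Finset.sum_congr rfl fun l _ => ?_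
          rw [Finset.sum_congr rfl fun k' _ => Finset.sum_comm, Finset.sum_comm]
          refine Finset.sum_congr rfl fun k _ => ?_
          rw [Finset.sum_comm]
          exact Finset.sum_congr rfl fun j _ => Finset.sum_congr rfl fun k' _ => by ring
      _ = _ := by
          rw [Finset.sum_congr rfl fun i _ => Finset.sum_comm, Finset.sum_comm]
          refine Finset.sum_congr rfl fun k _ => ?_
          rw [Finset.sum_congr rfl fun i _ => Finset.sum_comm, Finset.sum_comm]
          refine Finset.sum_congr rfl fun j _ => ?_
          rw [Finset.sum_congr rfl fun i _ => Finset.sum_comm, Finset.sum_comm]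
  have hc : ∀ k : Fin n → ℤ, Integrable (expi k) (volume.restrict (box n)) := fun k =>
    (continuous_expi k).integrableOn_box
  simp only [hexp]
  rw [integral_finsetSum _ fun k _ => integrable_finsetSum _ fun j _ =>
    integrable_finsetSum _ fun k' _ => (hc _).const_mul _]
  refine Finset.sum_congr rfl fun k _ => ?_
  rw [integral_finsetSum _ fun j _ => integrable_finsetSum _ fun k' _ => (hc _).const_mul _]
  refine Finset.sum_congr rfl fun j _ => ?_
  rw [integral_finsetSum _ fun k' _ => (hc _).const_mul _]
  simp only [integral_const_mul, setIntegral_expi, mul_ite, mul_one, mul_zero, sub_eq_zero]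
  rw [Finset.sum_ite_eq]
  split_ifs with h
  · rfl
  · rw [hU _ h, mul_zero]

lemma abs_le_sqrt_freqSq {n : ℕ} (k : Fin n → ℤ) (i : Fin n) : |(k i : ℝ)| ≤ √(freqSq k) := by
  refine Real.abs_le_sqrt ?_
  exact Finset.single_le_sum (f := fun i => (k i : ℝ) ^ 2) (fun i _ => sq_nonneg _)
    (Finset.mem_univ i)

lemma exists_symbol_bound {n : ℕ} (J : Finset (Fin n → ℤ))
    (a : (Fin n → ℤ) → Matrix (Fin n) (Fin n) ℂ) :
    ∃ C : ℝ, 0 ≤ C ∧ ∀ j ∈ J, ∀ k : Fin n → ℤ,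
      ‖∑ i, ∑ l, (k i : ℂ) * a j i l * (k + j) l‖ ≤ C * (√(freqSq k) * √(freqSq (k + j))) := by
  have h0 : ∀ j, 0 ≤ ∑ i, ∑ l, ‖a j i l‖ := fun j => by positivity
  refine ⟨∑ j ∈ J, ∑ i, ∑ l, ‖a j i l‖, by positivity, fun j hj k => ?_⟩
  refine le_trans ?_ (mul_le_mul_of_nonneg_right
    (Finset.single_le_sum (f := fun j => ∑ i, ∑ l, ‖a j i l‖) (fun j _ => h0 j) hj)
    (by positivity))
  simp only [Finset.sum_mul]
  refine (norm_sum_le _ _).trans (Finset.sum_le_sum fun i _ => ?_)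
  refine (norm_sum_le _ _).trans (Finset.sum_le_sum fun l _ => ?_)
  rw [norm_mul, norm_mul, Complex.norm_intCast, Complex.norm_intCast]
  calc _ = ‖a j i l‖ * (|(k i : ℝ)| * |((k + j) l : ℝ)|) := by ring
    _ ≤ _ := by
      gcongr
      · exact abs_le_sqrt_freqSq k i
      · exact abs_le_sqrt_freqSq (k + j) l

lemma re_conj_form_ge {n : ℕ} {M : Matrix (Fin n) (Fin n) ℝ} {θ : ℝ}
    (hM : ∀ v : Fin n → ℝ, θ * (v ⬝ᵥ v) ≤ v ⬝ᵥ M *ᵥ v) (w : Fin n → ℂ) :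
    θ * ∑ l, ‖w l‖ ^ 2 ≤ (∑ i, ∑ l, conj (w i) * (M i l : ℂ) * w l).re := by
  have h1 := hM fun i => (w i).re
  have h2 := hM fun i => (w i).im
  have h3 : ∑ l, ‖w l‖ ^ 2 = (fun i => (w i).re) ⬝ᵥ (fun i => (w i).re) +
      (fun i => (w i).im) ⬝ᵥ (fun i => (w i).im) := by
    simp only [dotProduct, ← Finset.sum_add_distrib]
    refine Finset.sum_congr rfl fun l _ => ?_
    rw [Complex.sq_norm, Complex.normSq_apply]
  have h4 : (∑ i, ∑ l, conj (w i) * (M i l : ℂ) * w l).re =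
      (fun i => (w i).re) ⬝ᵥ M *ᵥ (fun i => (w i).re) +
      (fun i => (w i).im) ⬝ᵥ M *ᵥ (fun i => (w i).im) := by
    simp only [dotProduct, Matrix.mulVec, ← Finset.sum_add_distrib, Complex.re_sum,
      Finset.mul_sum]
    refine Finset.sum_congr rfl fun i _ => Finset.sum_congr rfl fun l _ => ?_
    simp
    ring
  rw [h3, h4]
  linarith

lemma coercive_symbol {n : ℕ} {J : Finset (Fin n → ℤ)}
    {a : (Fin n → ℤ) → Matrix (Fin n) (Fin n) ℂ} {A : (Fin n → ℝ) → Matrix (Fin n) (Fin n) ℝ}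
    {θ : ℝ} (ha : ∀ x i l, (A x i l : ℂ) = ∑ j ∈ J, a j i l * expi j x)
    (hA : ∀ (x v : Fin n → ℝ), θ * (v ⬝ᵥ v) ≤ v ⬝ᵥ A x *ᵥ v)
    (U : (Fin n → ℤ) → ℂ) (F : Finset (Fin n → ℤ)) (hU : ∀ k ∉ F, U k = 0) :
    θ * ∑ k ∈ F, freqSq k * ‖U k‖ ^ 2 ≤ (∑ k ∈ F, ∑ j ∈ J,
      conj (U k) * (∑ i, ∑ l, k i * a j i l * (k + j) l) * U (k + j)).re := by
  classical
  let w : (Fin n → ℝ) → Fin n → ℂ := fun x l => ∑ k ∈ F, k l * U k * expi (-k) x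
  have hw : ∀ l, Continuous fun x => w x l := fun l =>
    continuous_finsetSum _ fun k _ => continuous_const.mul (continuous_expi _)
  have hAc : ∀ i l, Continuous fun x => (A x i l : ℂ) := fun i l => by
    simp only [ha]
    exact continuous_finsetSum _ fun k _ => continuous_const.mul (continuous_expi _)
  have hcc := Complex.continuous_conj
  have h1 := setIntegral_quadratic_form (J := J) (a := a) hU
  have h2 := setIntegral_quadratic_form (J := {0}) (a := fun _ => (1 : Matrix (Fin n) (Fin n) ℂ))
    hU
  rw [← h1]
  have h3 : ∑ k ∈ F, freqSq k * ‖U k‖ ^ 2 = ∫ x in box n, ∑ l, ‖w x l‖ ^ 2 := by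
    have h4 : ((∑ k ∈ F, freqSq k * ‖U k‖ ^ 2 : ℝ) : ℂ) =
        ((∫ x in box n, ∑ l, ‖w x l‖ ^ 2 : ℝ) : ℂ) := by
      rw [← integral_complex_ofReal]
      convert h2.symm using 1
      · push_cast
        refine Finset.sum_congr rfl fun k _ => ?_
        simp only [Finset.sum_singleton, add_zero, Matrix.one_apply, mul_ite, mul_one, mul_zero,
          ite_mul, zero_mul, Finset.sum_ite_eq, Finset.mem_univ, if_true, freqSq]
        push_cast
        rw [← Complex.conj_mul']
        simp only [sq]
        ring
      · congr 1
        ext x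
        push_cast
        simp only [Finset.sum_singleton, expi_zero, Matrix.one_apply, mul_one, mul_ite, mul_zero,
          ite_mul, zero_mul, Finset.sum_ite_eq, Finset.mem_univ, if_true]
        refine Finset.sum_congr rfl fun l _ => ?_
        rw [← Complex.conj_mul']
    exact_mod_cast h4
  have hi : Integrable (fun x => ∑ i, ∑ l, conj (w x i) * (A x i l : ℂ) * w x l)
      (volume.restrict (box n)) :=
    Continuous.integrableOn_box (continuous_finsetSum _ fun i _ => continuous_finsetSum _
      fun l _ => ((hcc.comp (hw i)).mul (hAc i l)).mul (hw l))
  have h5 : (∫ x in box n, ∑ i, ∑ l, conj (∑ k ∈ F, k i * U k * expi (-k) x) *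
        (∑ j ∈ J, a j i l * expi j x) * ∑ k ∈ F, k l * U k * expi (-k) x).re =
      ∫ x in box n, (∑ i, ∑ l, conj (w x i) * (A x i l : ℂ) * w x l).re := by
    simp only [← ha]
    exact (integral_re hi).symm
  rw [h5, h3, ← integral_const_mul]
  refine integral_mono (Integrable.const_mul ?_ θ) hi.re fun x => re_conj_form_ge (hA x) (w x)
  exact Continuous.integrableOn_box (continuous_finsetSum _ fun l _ => ((hw l).norm.pow 2))

/-- The projection of `ℝ^n` onto the torus. -/
def toTorus {n : ℕ} (x : Fin n → ℝ) : UnitAddTorus (Fin n) := fun i => (x i : UnitAddCircle)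

lemma isOpenQuotientMap_toTorus (n : ℕ) : IsOpenQuotientMap (toTorus (n := n)) :=
  IsOpenQuotientMap.piMap (f := fun (_ : Fin n) (t : ℝ) => (t : UnitAddCircle))
    fun _ => QuotientAddGroup.isOpenQuotientMap_mk

lemma mFourier_toTorus {n : ℕ} (k : Fin n → ℤ) (x : Fin n → ℝ) :
    UnitAddTorus.mFourier k (toTorus x) = expi k x := by
  simp only [UnitAddTorus.mFourier, toTorus, ContinuousMap.coe_mk, fourier_coe_apply]
  rw [← Complex.exp_sum, expi, phase_apply]
  push_cast
  rw [Finset.sum_mul]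
  congr 1
  exact Finset.sum_congr rfl fun i _ => by ring

lemma ZPeriodic.exists_continuousMap {n : ℕ} {G : (Fin n → ℝ) → ℂ} (hG : ZPeriodic G)
    (hc : Continuous G) : ∃ f : C(UnitAddTorus (Fin n), ℂ), ∀ x, f (toTorus x) = G x := by
  let q : C(Fin n → ℝ, UnitAddTorus (Fin n)) := ⟨toTorus, (isOpenQuotientMap_toTorus n).continuous⟩
  have hq : IsQuotientMap q := (isOpenQuotientMap_toTorus n).isQuotientMap
  have hfac : Function.FactorsThrough (⟨G, hc⟩ : C(Fin n → ℝ, ℂ)) q := by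
    intro x y hxy
    have h1 : ∀ i, ∃ m : ℤ, (m : ℝ) = x i - y i := fun i => by
      have h2 : ((x i - y i : ℝ) : UnitAddCircle) = 0 := by
        rw [AddCircle.coe_sub, sub_eq_zero]
        exact congrFun hxy i
      obtain ⟨m, hm⟩ := (AddCircle.coe_eq_zero_iff (1 : ℝ)).1 h2
      exact ⟨m, by simpa using hm⟩
    choose m hm using h1
    have : x = y + fun i => (m i : ℝ) := by
      ext i
      simp [hm]
    rw [this]
    exact hG y m
  refine ⟨hq.lift _ hfac, fun x => ?_⟩
  exact DFunLike.congr_fun (hq.lift_comp _ hfac) x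

/-- Integration over the unit box as a functional on continuous functions on the torus. -/
def boxIntegralCLM (n : ℕ) : C(UnitAddTorus (Fin n), ℂ) →L[ℂ] ℂ :=
  LinearMap.mkContinuous
    { toFun := fun f => ∫ x in box n, f (toTorus x)
      map_add' := fun f g => integral_add
        (f.continuous.comp (isOpenQuotientMap_toTorus n).continuous).integrableOn_box
        (g.continuous.comp (isOpenQuotientMap_toTorus n).continuous).integrableOn_box
      map_smul' := fun c f => integral_const_mul c _ } 1 fun f => by
    have := norm_setIntegral_le_of_norm_le_const (μ := volume) (s := box n)
      (f := fun x => f (toTorus x)) (C := ‖f‖) (by simp [volume_box])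
      fun x _ => f.norm_coe_le_norm _
    simpa [Measure.real, volume_box] using this

lemma boxIntegralCLM_apply {n : ℕ} (f : C(UnitAddTorus (Fin n), ℂ)) :
    boxIntegralCLM n f = ∫ x in box n, f (toTorus x) := rfl

/-- A continuous functional vanishing on a subspace and not at a point outside its closure. -/
lemma exists_functional_ne_zero {X : Type*} [NormedAddCommGroup X] [NormedSpace ℂ X]
    {W : Submodule ℂ X} {f : X} (hf : f ∉ closure (W : Set X)) :
    ∃ L : StrongDual ℂ X, (∀ w ∈ W, L w = 0) ∧ L f ≠ 0 := by
  let : NormedSpace ℝ X := NormedSpace.restrictScalars ℝ ℂ X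
  have hconv : Convex ℝ (closure (W : Set X)) := by
    have h := (W.restrictScalars ℝ).convex
    exact h.closure
  obtain ⟨L, b, hL, hb⟩ := RCLike.geometric_hahn_banach_closed_point (𝕜 := ℂ) hconv
    isClosed_closure hf
  refine ⟨L, fun w hw => ?_, fun h0 => ?_⟩
  · by_contra hne
    have h1 : 0 < ‖L w‖ ^ 2 := by positivity
    have h2 := hL (((b / ‖L w‖ ^ 2 : ℝ) * conj (L w)) • w) (subset_closure (W.smul_mem _ hw))
    rw [map_smul, smul_eq_mul, mul_assoc, Complex.conj_mul', ← Complex.ofReal_pow,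
      ← Complex.ofReal_mul] at h2
    simp only [RCLike.re_to_complex, Complex.ofReal_re] at h2
    rw [div_mul_cancel₀ _ h1.ne'] at h2
    exact lt_irrefl _ h2
  · have h1 := hL 0 (subset_closure W.zero_mem)
    simp only [map_zero] at h1
    rw [h0, map_zero] at hb
    exact lt_asymm h1 hb

/-- The linear elliptic equation `tr(A D²u) = g` with divergence-free trigonometric coefficients
is solvable up to a uniformly small error by a trigonometric polynomial; the matrix field is the
Hessian of the latter. -/
lemma exists_approx_solution {n : ℕ} {J : Finset (Fin n → ℤ)}
    {a : (Fin n → ℤ) → Matrix (Fin n) (Fin n) ℂ} {A : (Fin n → ℝ) → Matrix (Fin n) (Fin n) ℝ}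
    {θ : ℝ} (hθ : 0 < θ) (ha : ∀ x i l, (A x i l : ℂ) = ∑ j ∈ J, a j i l * expi j x)
    (hA : ∀ (x v : Fin n → ℝ), θ * (v ⬝ᵥ v) ≤ v ⬝ᵥ A x *ᵥ v)
    (hdiv : ∀ j ∈ J, ∀ i, ∑ l, a j i l * j l = 0)
    {g : (Fin n → ℝ) → ℝ} (hg : ZPeriodic g) (hgc : Continuous g) (hg0 : ∫ x in box n, g x = 0)
    {δ : ℝ} (hδ : 0 < δ) :
    ∃ (F : Finset (Fin n → ℤ)) (c : (Fin n → ℤ) → ℂ), ∀ x,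
      |∑ i, ∑ l, A x i l * (∑ k ∈ F, c k * (k i * k l) * expi k x).re - g x| ≤ δ := by
  classical
  obtain ⟨f, hf⟩ := ZPeriodic.exists_continuousMap (G := fun x => (g x : ℂ))
    (fun x m => by simp only [hg x m]) (by fun_prop)
  let β : (Fin n → ℤ) → (Fin n → ℤ) → ℂ := fun j k => ∑ i, ∑ l, k i * a j i l * (k + j) l
  have hβ' : ∀ j ∈ J, ∀ k, β j k = ∑ i, ∑ l, k i * a j i l * k l := fun j hj k => by
    refine Finset.sum_congr rfl fun i _ => ?_
    have h1 : ∑ l, (k i : ℂ) * a j i l * (k + j) l =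
        ∑ l, (k i : ℂ) * a j i l * k l + k i * ∑ l, a j i l * j l := by
      rw [Finset.mul_sum, ← Finset.sum_add_distrib]
      refine Finset.sum_congr rfl fun l _ => ?_
      push_cast [Pi.add_apply]
      ring
    rw [h1, hdiv j hj, mul_zero, add_zero]
  let Le : (Fin n → ℤ) → C(UnitAddTorus (Fin n), ℂ) := fun k =>
    ∑ j ∈ J, β j k • UnitAddTorus.mFourier (k + j)
  have hLe : ∀ k x, Le k (toTorus x) = ∑ i, ∑ l, (A x i l : ℂ) * (k i * k l * expi k x) := by
    intro k x
    simp only [Le, ContinuousMap.coe_sum, Finset.sum_apply, ContinuousMap.coe_smul, Pi.smul_apply,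
      mFourier_toTorus, smul_eq_mul]
    rw [Finset.sum_congr rfl fun j hj => by rw [hβ' j hj]]
    simp only [ha, Finset.sum_mul, expi_add]
    rw [Finset.sum_comm]
    refine Finset.sum_congr rfl fun i _ => ?_
    rw [Finset.sum_comm]
    exact Finset.sum_congr rfl fun l _ => Finset.sum_congr rfl fun j _ => by ring
  have hmem : f ∈ closure (Submodule.span ℂ (Set.range Le) : Set C(UnitAddTorus (Fin n), ℂ)) := by
    by_contra hcl
    obtain ⟨L, hL0, hLf⟩ := exists_functional_ne_zero hcl
    obtain ⟨C, hC, hCβ⟩ := exists_symbol_bound J a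
    have hm : ∀ k, k ≠ 0 → L (UnitAddTorus.mFourier k) = 0 := fun k hk => by
      refine eq_zero_of_coercive (m := fun k => L (UnitAddTorus.mFourier k)) (M := ‖L‖) hC hθ hCβ
        (coercive_symbol ha hA) (fun k => ?_) (fun k => ?_) hk
      · simpa [UnitAddTorus.mFourier_norm] using L.le_opNorm (UnitAddTorus.mFourier k)
      · have := hL0 (Le k) (Submodule.subset_span ⟨k, rfl⟩)
        simpa [Le, β, map_sum] using this
    have hLI : L = L (UnitAddTorus.mFourier 0) • boxIntegralCLM n := by
      refine ContinuousLinearMap.ext_on (s := Set.range (UnitAddTorus.mFourier (d := Fin n))) ?_ ?_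
      · rw [dense_iff_closure_eq, ← Submodule.topologicalClosure_coe,
          UnitAddTorus.span_mFourier_closure_eq_top]
        rfl
      · rintro _ ⟨k, rfl⟩
        simp only [smul_apply, boxIntegralCLM_apply, mFourier_toTorus,
          setIntegral_expi, smul_eq_mul]
        split_ifs with h
        · simp [h]
        · simp [hm k h]
    apply hLf
    rw [hLI]
    simp only [smul_apply, boxIntegralCLM_apply, hf]
    rw [integral_complex_ofReal, hg0]
    simp
  obtain ⟨w, hw, hwf⟩ := Metric.mem_closure_iff.1 hmem δ hδ
  obtain ⟨c, rfl⟩ := Finsupp.mem_span_range_iff_exists_finsupp.1 hw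
  refine ⟨c.support, c, fun x => ?_⟩
  have h1 : ‖f (toTorus x) - (c.sum fun i a => a • Le i) (toTorus x)‖ ≤ δ := by
    rw [← dist_eq_norm]
    exact (ContinuousMap.dist_apply_le_dist _).trans hwf.le
  have h2 : ∑ i, ∑ l, A x i l * (∑ k ∈ c.support, c k * (k i * k l) * expi k x).re - g x =
      -(f (toTorus x) - (c.sum fun i a => a • Le i) (toTorus x)).re := by
    rw [hf]
    simp only [Finsupp.sum, ContinuousMap.coe_sum, Finset.sum_apply, ContinuousMap.coe_smul,
      Pi.smul_apply, smul_eq_mul, hLe, Complex.sub_re, Complex.ofReal_re, neg_sub]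
    congr 1
    have h3 : ∀ i l, A x i l * (∑ k ∈ c.support, c k * (k i * k l) * expi k x).re =
        ((A x i l : ℂ) * ∑ k ∈ c.support, c k * (k i * k l) * expi k x).re := fun i l => by
      rw [Complex.re_ofReal_mul]
    simp only [h3, ← Complex.re_sum]
    congr 1
    simp only [Finset.mul_sum]
    rw [Finset.sum_congr rfl fun i _ => Finset.sum_comm, Finset.sum_comm]
    refine Finset.sum_congr rfl fun k _ => Finset.sum_congr rfl fun i _ =>
      Finset.sum_congr rfl fun l _ => by ring
  rw [h2, abs_neg]
  exact (Complex.abs_re_le_norm _).trans h1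

lemma hasFDerivAt_re_sum_expi {n : ℕ} (F : Finset (Fin n → ℤ)) (d : (Fin n → ℤ) → ℂ)
    (x : Fin n → ℝ) :
    HasFDerivAt (fun y => (∑ k ∈ F, d k * expi k y).re) (Complex.reCLM ∘L
      ∑ k ∈ F, d k • ((expi k x * Complex.I) • (Complex.ofRealCLM ∘L phase k))) x :=
  Complex.reCLM.hasFDerivAt.comp x
    (HasFDerivAt.fun_sum fun k _ => (hasFDerivAt_expi k x).const_mul (d k))

/-- The real part of a trigonometric polynomial with matrix coefficients `c_k k ⊗ k`. -/
def trigHessian {n : ℕ} (F : Finset (Fin n → ℤ)) (c : (Fin n → ℤ) → ℂ) (x : Fin n → ℝ) :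
    Matrix (Fin n) (Fin n) ℝ :=
  Matrix.of fun i l => (∑ k ∈ F, c k * (k i * k l) * expi k x).re

lemma continuous_trigHessian {n : ℕ} (F : Finset (Fin n → ℤ)) (c : (Fin n → ℤ) → ℂ) :
    Continuous (trigHessian F c) := by
  refine continuous_matrix fun i l => Complex.continuous_re.comp ?_
  exact continuous_finsetSum _ fun k _ => (continuous_expi k).const_mul _

lemma det_le_setIntegral_det_trigHessian {n : ℕ} {S : Matrix (Fin n) (Fin n) ℝ} (hS : S.PosDef)
    (F : Finset (Fin n → ℤ)) (c : (Fin n → ℤ) → ℂ) :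
    ∃ E : Set (Fin n → ℝ), MeasurableSet E ∧ E ⊆ box n ∧
      (∀ x ∈ E, (S + trigHessian F c x).PosSemidef) ∧
      S.det ≤ ∫ x in E, (S + trigHessian F c x).det := by
  have hpi : (Real.pi : ℂ) ≠ 0 := by exact_mod_cast Real.pi_ne_zero
  let d : (Fin n → ℤ) → ℂ := fun k => -(c k / (4 * (Real.pi : ℂ) ^ 2))
  refine det_le_setIntegral_det hS (u := fun x => (∑ k ∈ F, d k * expi k x).re)
    (g := fun x i => (∑ k ∈ F, (d k * (2 * Real.pi * k i * Complex.I)) * expi k x).re)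
    (fun x m => ?_) (fun x m => ?_) (fun x m => ?_) ?_ (continuous_trigHessian F c) (fun x => ?_)
    (fun x v => ?_) fun x => ?_
  · simp only [zPeriodic_expi _ x m]
  · simp only [zPeriodic_expi _ x m]
  · simp only [trigHessian, zPeriodic_expi _ x m]
  · exact Complex.continuous_re.comp
      (continuous_finsetSum _ fun k _ => (continuous_expi k).const_mul _)
  · ext i l
    simp only [trigHessian, Matrix.conjTranspose_apply, Matrix.of_apply, star_trivial]
    simp only [mul_comm]
  · have h1 : HasDerivAt (fun t : ℝ => x + t • v) v 0 := by
      simpa using ((hasDerivAt_id (0 : ℝ)).smul_const v).const_add x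
    have h2 := hasFDerivAt_re_sum_expi F d x
    rw [show x = x + (0 : ℝ) • v by simp] at h2
    refine (h2.comp_hasDerivAt (0 : ℝ) h1).congr_deriv ?_
    simp only [zero_smul, add_zero, ContinuousLinearMap.comp_apply, sum_apply,
      smul_apply, smul_eq_mul, Complex.reCLM_apply, Complex.ofRealCLM_apply, phase_apply,
      dotProduct]
    simp only [← Complex.re_mul_ofReal, ← Complex.re_sum, Complex.ofReal_sum, Finset.mul_sum,
      Finset.sum_mul]
    rw [Finset.sum_comm]
    congr 1
    refine Finset.sum_congr rfl fun i _ => Finset.sum_congr rfl fun k _ => ?_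
    push_cast
    ring
  · refine hasFDerivAt_pi'.2 fun i => (hasFDerivAt_re_sum_expi F _ x).congr_fderiv ?_
    ext v
    simp only [ContinuousLinearMap.comp_apply, sum_apply, ContinuousLinearMap.proj_apply,
      LinearMap.coe_toContinuousLinearMap', Matrix.toLin'_apply, Matrix.mulVec, trigHessian,
      smul_apply, smul_eq_mul, Complex.reCLM_apply, Complex.ofRealCLM_apply, phase_apply,
      dotProduct, Matrix.of_apply]
    simp only [← Complex.re_mul_ofReal, ← Complex.re_sum, Complex.ofReal_sum, Finset.mul_sum,
      Finset.sum_mul]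
    rw [Finset.sum_comm]
    congr 1
    refine Finset.sum_congr rfl fun l _ => Finset.sum_congr rfl fun k _ => ?_
    simp only [d]
    push_cast
    field_simp
    linear_combination (-4 * c k * k i * expi k x * k l * v l) * Complex.I_sq

/-- The entrywise mean over the torus of a matrix field. -/
def meanMatrix {n : ℕ} (A : (Fin n → ℝ) → Matrix (Fin n) (Fin n) ℝ) : Matrix (Fin n) (Fin n) ℝ :=
  Matrix.of fun i j => ∫ x in box n, A x i j

lemma dotProduct_meanMatrix_mulVec {n : ℕ} {A : (Fin n → ℝ) → Matrix (Fin n) (Fin n) ℝ}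
    (hA : ∀ i j, IntegrableOn (fun x => A x i j) (box n)) (v : Fin n → ℝ) :
    v ⬝ᵥ meanMatrix A *ᵥ v = ∫ x in box n, v ⬝ᵥ A x *ᵥ v := by
  simp only [dotProduct, Matrix.mulVec, meanMatrix, Matrix.of_apply]
  rw [integral_finsetSum _ fun i _ => (integrable_finsetSum _ fun j _ =>
    (hA i j).mul_const _).const_mul _]
  refine Finset.sum_congr rfl fun i _ => ?_
  rw [integral_const_mul, integral_finsetSum _ fun j _ => (hA i j).mul_const _]
  simp only [integral_mul_const]

lemma integrableOn_dotProduct_mulVec {n : ℕ} {A : (Fin n → ℝ) → Matrix (Fin n) (Fin n) ℝ}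
    (hA : ∀ i j, IntegrableOn (fun x => A x i j) (box n)) (v : Fin n → ℝ) :
    IntegrableOn (fun x => v ⬝ᵥ A x *ᵥ v) (box n) := by
  simp only [dotProduct, Matrix.mulVec]
  exact integrable_finsetSum _ fun i _ => (integrable_finsetSum _ fun j _ =>
    (hA i j).mul_const _).const_mul _

lemma isHermitian_meanMatrix {n : ℕ} {A : (Fin n → ℝ) → Matrix (Fin n) (Fin n) ℝ}
    (hA : ∀ x, (A x).IsHermitian) : (meanMatrix A).IsHermitian := by
  ext i j
  simp only [meanMatrix, Matrix.conjTranspose_apply, Matrix.of_apply, star_trivial]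
  exact integral_congr_ae (ae_of_all _ fun x => by simpa using (hA x).apply i j)

lemma posSemidef_meanMatrix {n : ℕ} {A : (Fin n → ℝ) → Matrix (Fin n) (Fin n) ℝ}
    (hi : ∀ i j, IntegrableOn (fun x => A x i j) (box n)) (hA : ∀ x, (A x).PosSemidef) :
    (meanMatrix A).PosSemidef := by
  refine Matrix.PosSemidef.of_dotProduct_mulVec_nonneg
    (isHermitian_meanMatrix fun x => (hA x).isHermitian) fun v => ?_
  rw [star_trivial, dotProduct_meanMatrix_mulVec hi]
  exact integral_nonneg fun x => by simpa using (hA x).dotProduct_mulVec_nonneg v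

lemma posDef_meanMatrix {n : ℕ} {A : (Fin n → ℝ) → Matrix (Fin n) (Fin n) ℝ} {θ : ℝ} (hθ : 0 < θ)
    (hi : ∀ i j, IntegrableOn (fun x => A x i j) (box n)) (hs : ∀ x, (A x).IsHermitian)
    (hA : ∀ (x v : Fin n → ℝ), θ * (v ⬝ᵥ v) ≤ v ⬝ᵥ A x *ᵥ v) :
    (meanMatrix A).PosDef := by
  refine Matrix.PosDef.of_dotProduct_mulVec_pos (isHermitian_meanMatrix hs) fun v hv => ?_
  rw [star_trivial, dotProduct_meanMatrix_mulVec hi]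
  have h1 : θ * (v ⬝ᵥ v) ≤ ∫ x in box n, v ⬝ᵥ A x *ᵥ v := by
    have := setIntegral_mono (s := box n) (μ := volume) (f := fun _ => θ * (v ⬝ᵥ v))
      (integrable_const _) (integrableOn_dotProduct_mulVec hi v) fun x => hA x v
    simpa [Measure.real, volume_box] using this
  have h2 : 0 < v ⬝ᵥ v := by simpa using Matrix.dotProduct_star_self_pos_iff.2 hv
  exact (mul_pos hθ h2).trans_le h1

lemma posDef_of_forall_le {n : ℕ} {M : Matrix (Fin n) (Fin n) ℝ} {θ : ℝ} (hθ : 0 < θ)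
    (hs : M.IsHermitian) (hM : ∀ v, θ * (v ⬝ᵥ v) ≤ v ⬝ᵥ M *ᵥ v) : M.PosDef := by
  refine Matrix.PosDef.of_dotProduct_mulVec_pos hs fun v hv => ?_
  rw [star_trivial]
  have h2 : 0 < v ⬝ᵥ v := by simpa using Matrix.dotProduct_star_self_pos_iff.2 hv
  exact (mul_pos hθ h2).trans_le (hM v)

lemma le_rpow_of_forall_pow_le {m : ℕ} (hm : m ≠ 0) {P D : ℝ} (hP : 0 ≤ P) {N : ℕ}
    (h : ∀ κ > 0, P ^ m ≤ (1 + κ) ^ N * D) : P ≤ D ^ ((1 : ℝ) / m) := by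
  have hlim : Tendsto (fun κ : ℝ => (1 + κ) ^ N * D) (𝓝[>] 0) (𝓝 D) := by
    have : Tendsto (fun κ : ℝ => (1 + κ) ^ N * D) (𝓝 0) (𝓝 ((1 + 0) ^ N * D)) := by
      apply Continuous.tendsto
      fun_prop
    simpa using this.mono_left nhdsWithin_le_nhds
  have h1 : P ^ m ≤ D := ge_of_tendsto hlim (eventually_mem_nhdsWithin.mono fun κ hκ => h κ hκ)
  have h2 := Real.rpow_le_rpow (by positivity) h1 (z := (1 : ℝ) / m) (by positivity)
  rwa [← Real.rpow_natCast, ← Real.rpow_mul hP, mul_one_div_cancel (by exact_mod_cast hm),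
    Real.rpow_one] at h2

/-- The determinant inequality for uniformly positive definite divergence-free trigonometric
polynomials. -/
lemma setIntegral_det_rpow_le_of_trigPoly {n : ℕ} (hn : 2 ≤ n) {J : Finset (Fin n → ℤ)}
    {a : (Fin n → ℤ) → Matrix (Fin n) (Fin n) ℂ} {A : (Fin n → ℝ) → Matrix (Fin n) (Fin n) ℝ}
    {θ : ℝ} (hθ : 0 < θ) (ha : ∀ x i l, (A x i l : ℂ) = ∑ j ∈ J, a j i l * expi j x)
    (hs : ∀ x, (A x).IsHermitian) (hA : ∀ (x v : Fin n → ℝ), θ * (v ⬝ᵥ v) ≤ v ⬝ᵥ A x *ᵥ v)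
    (hdiv : ∀ j ∈ J, ∀ i, ∑ l, a j i l * j l = 0) :
    ∫ x in box n, (A x).det ^ ((1 : ℝ) / ((n : ℝ) - 1)) ≤
      (meanMatrix A).det ^ ((1 : ℝ) / ((n : ℝ) - 1)) := by
  obtain ⟨m, rfl⟩ : ∃ m, n = m + 1 := ⟨n - 1, by omega⟩
  have hm : m ≠ 0 := by omega
  have hm' : (m : ℝ) ≠ 0 := by exact_mod_cast hm
  have hA' : ∀ x i l, A x i l = (∑ j ∈ J, a j i l * expi j x).re := fun x i l => by
    rw [← ha, Complex.ofReal_re]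
  have hAc : Continuous A := continuous_matrix fun i l => by
    simp only [hA']
    exact Complex.continuous_re.comp
      (continuous_finsetSum _ fun k _ => (continuous_expi k).const_mul _)
  have hAp : ZPeriodic A := fun x p => by
    ext i l
    simp only [hA', zPeriodic_expi _ x p]
  have hAi : ∀ i l, IntegrableOn (fun x => A x i l) (box (m + 1)) := fun i l =>
    Continuous.integrableOn_box (by fun_prop)
  have hpd : ∀ x, (A x).PosDef := fun x => posDef_of_forall_le hθ (hs x) (hA x)
  push_cast
  rw [add_sub_cancel_right]
  set f : (Fin (m + 1) → ℝ) → ℝ := fun x => (A x).det ^ ((1 : ℝ) / m) with hf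
  have hfpos : ∀ x, 0 < f x := fun x => Real.rpow_pos_of_pos (hpd x).det_pos _
  have hfpow : ∀ x, f x ^ m = (A x).det := fun x => by
    rw [hf, ← Real.rpow_natCast, ← Real.rpow_mul (hpd x).det_pos.le, one_div_mul_cancel hm',
      Real.rpow_one]
  have hfc : Continuous f := (hAc.matrix_det).rpow_const fun x => Or.inl (hpd x).det_pos.ne'
  have hfp : ZPeriodic f := fun x p => by simp only [hf, hAp x p]
  obtain ⟨μ, hμ, hμf⟩ : ∃ μ > 0, ∀ x, μ ≤ f x := by
    obtain ⟨M, hM⟩ := ZPeriodic.exists_bound (u := fun x => (f x)⁻¹)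
      (fun x p => by simp only [hfp x p]) (hfc.inv₀ fun x => (hfpos x).ne')
    have hM0 : 0 < M := lt_of_lt_of_le (norm_pos_iff.2 (inv_ne_zero (hfpos 0).ne')) (hM 0)
    refine ⟨M⁻¹, by positivity, fun x => ?_⟩
    have := hM x
    rw [Real.norm_of_nonneg (by have := hfpos x; positivity)] at this
    exact inv_le_of_inv_le₀ (hfpos x) this
  set P : ℝ := ∫ x in box (m + 1), f x with hPdef
  have hP : 0 < P := by
    have := setIntegral_mono (s := box (m + 1)) (μ := volume) (f := fun _ => μ)
      (integrable_const _) hfc.integrableOn_box hμf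
    refine hμ.trans_le ?_
    simpa [Measure.real, volume_box] using this
  have hmean := posDef_meanMatrix hθ hAi hs hA
  set S := (meanMatrix A)⁻¹ with hSdef
  have hS : S.PosDef := hmean.inv
  have htr : ∫ x in box (m + 1), (A x * S).trace = m + 1 := by
    have h1 : ((meanMatrix A) * S).trace = m + 1 := by
      rw [hSdef, Matrix.mul_nonsing_inv _ hmean.det_pos.ne'.isUnit]
      simp
    rw [← h1]
    simp only [Matrix.trace, Matrix.diag_apply, Matrix.mul_apply, meanMatrix, Matrix.of_apply]
    rw [integral_finsetSum _ fun i _ => integrable_finsetSum _ fun j _ => (hAi i j).mul_const _]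
    refine Finset.sum_congr rfl fun i _ => ?_
    rw [integral_finsetSum _ fun j _ => (hAi i j).mul_const _]
    simp only [integral_mul_const]
  have htrc : Continuous fun x => (A x * S).trace :=
    (hAc.matrix_mul continuous_const).matrix_trace
  refine le_rpow_of_forall_pow_le hm hP.le (N := m + 1) fun κ hκ => ?_
  obtain ⟨F, c, hFc⟩ := exists_approx_solution hθ ha hA hdiv
    (g := fun x => (m + 1) * (f x / P) - (A x * S).trace)
    (fun x p => by simp only [hfp x p, hAp x p]) (by fun_prop)
    (by
      rw [integral_sub ((hfc.div_const P).const_mul _).integrableOn_box htrc.integrableOn_box,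
        integral_const_mul, integral_div, htr, ← hPdef, div_self hP.ne', mul_one, sub_self])
    (δ := (m + 1) * (μ * κ / P)) (by positivity)
  obtain ⟨E, hEm, hEb, hEp, hEd⟩ := det_le_setIntegral_det_trigHessian hS F c
  have hle : ∀ x ∈ E, (S + trigHessian F c x).det ≤ ((1 + κ) / P) ^ (m + 1) * f x := by
    intro x hx
    have h1 := (hpd x).posSemidef.det_mul_det_le m.succ_ne_zero (hEp x hx)
    have h2 : (A x * (S + trigHessian F c x)).trace ≤ (m + 1) * ((1 + κ) / P * f x) := by
      have h3 : (A x * trigHessian F c x).trace =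
          ∑ i, ∑ l, A x i l * (∑ k ∈ F, c k * (k i * k l) * expi k x).re := by
        simp only [Matrix.trace, Matrix.diag_apply, Matrix.mul_apply, trigHessian, Matrix.of_apply]
        exact Finset.sum_congr rfl fun i _ => Finset.sum_congr rfl fun l _ => by
          simp only [mul_comm]
      have h4 := (abs_le.1 (hFc x)).2
      rw [Matrix.mul_add, Matrix.trace_add, h3]
      have h5 : (m + 1 : ℝ) * (μ * κ / P) ≤ (m + 1) * (f x * κ / P) := by
        gcongr
        exact hμf x
      calc _ ≤ (m + 1) * (f x / P) + (m + 1) * (f x * κ / P) := by linarith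
        _ = _ := by ring
    have h3 : (A x * (S + trigHessian F c x)).trace / ((m + 1 : ℕ) : ℝ) ≤ (1 + κ) / P * f x := by
      rw [div_le_iff₀ (by positivity), mul_comm]
      exact_mod_cast h2
    have h4 := h1.trans (pow_le_pow_left₀
      (div_nonneg ((hpd x).posSemidef.trace_mul_nonneg (hEp x hx)) (Nat.cast_nonneg _)) h3 (m + 1))
    rw [← hfpow x, mul_pow, pow_succ (f x)] at h4
    have h5 : 0 < f x ^ m := pow_pos (hfpos x) m
    refine le_of_mul_le_mul_left (h4.trans_eq ?_) h5
    ring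
  have h_int : IntegrableOn (fun x => (S + trigHessian F c x).det) E :=
    (Continuous.integrableOn_box
      (continuous_const.add (continuous_trigHessian F c)).matrix_det).mono_set hEb
  have hfE : IntegrableOn (fun x => ((1 + κ) / P) ^ (m + 1) * f x) (box (m + 1)) :=
    (hfc.const_mul _).integrableOn_box
  have h1 : S.det ≤ ((1 + κ) / P) ^ (m + 1) * P := by
    calc S.det ≤ ∫ x in E, (S + trigHessian F c x).det := hEd
      _ ≤ ∫ x in E, ((1 + κ) / P) ^ (m + 1) * f x :=
        setIntegral_mono_on h_int (hfE.mono_set hEb) hEm hle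
      _ ≤ ∫ x in box (m + 1), ((1 + κ) / P) ^ (m + 1) * f x :=
        setIntegral_mono_set hfE (ae_of_all _ fun x => by have := hfpos x; positivity)
          hEb.eventuallyLE
      _ = _ := integral_const_mul _ _
  have h2 : S.det = (meanMatrix A).det⁻¹ := by
    rw [hSdef, Matrix.det_nonsing_inv, Ring.inverse_eq_inv']
  rw [h2, inv_le_iff_one_le_mul₀ hmean.det_pos] at h1
  have h3 : ((1 + κ) / P) ^ (m + 1) * P * (meanMatrix A).det * P ^ m =
      (1 + κ) ^ (m + 1) * (meanMatrix A).det := by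
    rw [div_pow]
    field_simp
    ring
  rw [← h3]
  exact le_mul_of_one_le_left (by positivity) h1

/-- The characters of the torus as a monoid homomorphism. -/
def expiHom (n : ℕ) : Multiplicative (Fin n → ℤ) →* ((Fin n → ℝ) → ℂ) where
  toFun k := expi k.toAdd
  map_one' := funext expi_zero
  map_mul' j k := funext (expi_add j.toAdd k.toAdd)

lemma exists_eq_sum_expi {n : ℕ} {f : (Fin n → ℝ) → ℂ}
    (hf : f ∈ Algebra.adjoin ℂ (Set.range (expi (n := n)))) :
    ∃ (J : Finset (Fin n → ℤ)) (κ : (Fin n → ℤ) → ℂ), 0 ∈ J ∧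
      ∀ z, f z = ∑ k ∈ J, κ k * expi k z := by
  classical
  have h1 : (Submonoid.closure (Set.range (expi (n := n))) : Set ((Fin n → ℝ) → ℂ)) =
      Set.range (expi (n := n)) :=
    congrArg SetLike.coe (Submonoid.closure_eq (MonoidHom.mrange (expiHom n)))
  rw [← Subalgebra.mem_toSubmodule, Algebra.adjoin_eq_span, h1] at hf
  obtain ⟨c, rfl⟩ := Finsupp.mem_span_range_iff_exists_finsupp.1 hf
  refine ⟨insert 0 c.support, c, Finset.mem_insert_self _ _, fun z => ?_⟩
  rw [Finsupp.sum_of_support_subset c (Finset.subset_insert 0 _) (fun i a => a • expi i) fun _ _ =>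
    zero_smul _ _]
  simp

lemma setIntegral_sum_expi {n : ℕ} {J : Finset (Fin n → ℤ)} (κ : (Fin n → ℤ) → ℂ) (h0 : 0 ∈ J) :
    ∫ x in box n, ∑ k ∈ J, κ k * expi k x = κ 0 := by
  classical
  rw [integral_finsetSum _ fun k _ => ((continuous_expi k).integrableOn_box).const_mul _]
  simp [integral_const_mul, setIntegral_expi, h0]

/-- A nonnegative trigonometric polynomial with unique maximum modulo periods at the origin. -/
def peak {n : ℕ} (z : Fin n → ℝ) : ℝ := ∑ i, (1 + (expi (Pi.single i 1) z).re)

lemma expi_single_re {n : ℕ} (i : Fin n) (z : Fin n → ℝ) :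
    (expi (Pi.single i 1) z).re = Real.cos (2 * Real.pi * z i) := by
  rw [expi, Complex.exp_ofReal_mul_I_re, phase_apply,
    Finset.sum_eq_single i (by intro b _ hb; simp [hb]) (by simp)]
  simp

lemma continuous_peak {n : ℕ} : Continuous (peak (n := n)) :=
  continuous_finsetSum _ fun _ _ =>
    continuous_const.add (Complex.continuous_re.comp (continuous_expi _))

lemma zPeriodic_peak {n : ℕ} : ZPeriodic (peak (n := n)) := fun x m => by
  simp only [peak, zPeriodic_expi _ x m]

lemma peak_nonneg {n : ℕ} (z : Fin n → ℝ) : 0 ≤ peak z :=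
  Finset.sum_nonneg fun i _ => by
    rw [expi_single_re]
    linarith [Real.neg_one_le_cos (2 * Real.pi * z i)]

lemma peak_neg {n : ℕ} (z : Fin n → ℝ) : peak (-z) = peak z := by
  simp only [peak, expi_single_re, Pi.neg_apply, mul_neg, Real.cos_neg]

lemma peak_zero {n : ℕ} : peak (0 : Fin n → ℝ) = 2 * n := by
  simp only [peak, expi_single_re, Pi.zero_apply, mul_zero, Real.cos_zero, Finset.sum_const,
    Finset.card_univ, Fintype.card_fin, nsmul_eq_mul]
  ring

lemma peak_mem_adjoin {n : ℕ} :
    (fun z : Fin n → ℝ => (peak z : ℂ)) ∈ Algebra.adjoin ℂ (Set.range (expi (n := n))) := by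
  have h : (fun z : Fin n → ℝ => (peak z : ℂ)) =
      ∑ i, (1 + (2⁻¹ : ℂ) • (expi (Pi.single i 1) + expi (-Pi.single i 1))) := by
    funext z
    simp only [peak, Finset.sum_apply, Pi.add_apply, Pi.smul_apply, Pi.one_apply, smul_eq_mul,
      ← conj_expi, Complex.ofReal_sum, Complex.add_conj]
    refine Finset.sum_congr rfl fun i _ => ?_
    push_cast
    ring
  rw [h]
  have hk : ∀ k : Fin n → ℤ, expi k ∈ Algebra.adjoin ℂ (Set.range (expi (n := n))) := fun k =>
    Algebra.subset_adjoin ⟨k, rfl⟩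
  exact sum_mem fun i _ => add_mem (one_mem _) (Subalgebra.smul_mem _ (add_mem (hk _) (hk _)) _)

lemma peak_sub_half_lt {n : ℕ} {z : Fin n → ℝ} (hz : z ∈ Set.Icc (0 : Fin n → ℝ) 1)
    (hne : z ≠ fun _ => 1 / 2) : peak (z - fun _ => 1 / 2) < peak (0 : Fin n → ℝ) := by
  obtain ⟨i, hi⟩ : ∃ i, z i ≠ 1 / 2 := by
    by_contra! h
    exact hne (funext h)
  simp only [peak, expi_single_re, Pi.sub_apply, Pi.zero_apply, mul_zero, Real.cos_zero]
  refine Finset.sum_lt_sum (fun j _ => by gcongr; exact Real.cos_le_one _)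
    ⟨i, Finset.mem_univ i, ?_⟩
  refine add_lt_add_right (lt_of_le_of_ne (Real.cos_le_one _) fun h => hi ?_) 1
  have h0 := hz.1 i
  have h1 := hz.2 i
  simp only [Pi.zero_apply, Pi.one_apply] at h0 h1
  have := (Real.cos_eq_one_iff_of_lt_of_lt (by nlinarith [Real.pi_pos])
    (by nlinarith [Real.pi_pos])).1 h
  have hpi := Real.pi_pos
  nlinarith [mul_eq_zero.1 this]

/-- The normalized powers of `peak`. -/
def peakKernel {n : ℕ} (N : ℕ) (z : Fin n → ℝ) : ℝ := (∫ y in box n, peak y ^ N)⁻¹ * peak z ^ N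

lemma peakKernel_nonneg {n : ℕ} (N : ℕ) (z : Fin n → ℝ) : 0 ≤ peakKernel N z :=
  mul_nonneg (inv_nonneg.2 (integral_nonneg fun y => pow_nonneg (peak_nonneg y) N))
    (pow_nonneg (peak_nonneg z) N)

lemma continuous_peakKernel {n : ℕ} (N : ℕ) : Continuous (peakKernel (n := n) N) :=
  (continuous_peak.pow N).const_mul _

lemma zPeriodic_peakKernel {n : ℕ} (N : ℕ) : ZPeriodic (peakKernel (n := n) N) := fun x m => by
  simp only [peakKernel, zPeriodic_peak x m]

lemma peakKernel_neg {n : ℕ} (N : ℕ) (z : Fin n → ℝ) : peakKernel N (-z) = peakKernel N z := by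
  simp only [peakKernel, peak_neg]

lemma exists_peakKernel_eq_sum {n : ℕ} (N : ℕ) :
    ∃ (J : Finset (Fin n → ℤ)) (κ : (Fin n → ℤ) → ℂ), 0 ∈ J ∧
      ∀ z : Fin n → ℝ, (peakKernel N z : ℂ) = ∑ k ∈ J, κ k * expi k z := by
  refine exists_eq_sum_expi (f := fun z => (peakKernel N z : ℂ)) ?_
  have : (fun z : Fin n → ℝ => (peakKernel N z : ℂ)) =
      (((∫ y in box n, peak y ^ N)⁻¹ : ℝ) : ℂ) • (fun z : Fin n → ℝ => (peak z : ℂ)) ^ N := by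
    funext z
    simp [peakKernel]
  rw [this]
  exact Subalgebra.smul_mem _ (pow_mem peak_mem_adjoin N) _

lemma tendsto_setIntegral_peakKernel {n : ℕ} (hn : n ≠ 0) {G : (Fin n → ℝ) → ℝ}
    (hG : ZPeriodic G) (hGc : Continuous G) (x : Fin n → ℝ) :
    Tendsto (fun N : ℕ => ∫ y in box n, peakKernel N (x - y) * G y) atTop (𝓝 (G x)) := by
  let w : Fin n → ℝ := fun _ => 1 / 2
  have hc : Continuous fun z : Fin n → ℝ => peak (z - w) := continuous_peak.comp (by fun_prop)
  have hw : w ∈ interior (Set.Icc (0 : Fin n → ℝ) 1) := by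
    rw [← Set.pi_univ_Icc, interior_pi_set Set.finite_univ]
    intro i _
    simp only [interior_Icc, w]
    norm_num
  have h := tendsto_setIntegral_pow_smul_of_unique_maximum_of_isCompact_of_continuousOn
    (μ := volume) (isCompact_Icc (a := (0 : Fin n → ℝ)) (b := 1)) (x₀ := w)
    (c := fun z => peak (z - w)) (g := fun z => G (z + (x - w))) hc.continuousOn
    (fun y hy hne => by simpa only [sub_self] using peak_sub_half_lt hy hne)
    (fun y _ => peak_nonneg _)
    (by rw [sub_self, peak_zero]; positivity) (subset_closure hw) (by fun_prop)
  rw [add_sub_cancel] at h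
  refine h.congr fun N => ?_
  have hp : ZPeriodic fun z : Fin n → ℝ => peak z ^ N := fun z m => by
    simp only [zPeriodic_peak z m]
  have hp' : ZPeriodic fun y => peakKernel N (y - x) * G y := fun y m => by
    simp only [add_sub_right_comm, zPeriodic_peakKernel N _ m, hG y m]
  have h1 : ∀ y, peakKernel N (x - y) = peakKernel N (y - x) := fun y => by
    rw [← peakKernel_neg, neg_sub]
  simp only [h1]
  rw [← hp'.setIntegral_comp_add (x - w), ← setIntegral_congr_set (box_ae_eq_Icc n),
    ← setIntegral_congr_set (box_ae_eq_Icc n), smul_eq_mul, ← integral_const_mul,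
    show (∫ z in box n, peak (z - w) ^ N) = ∫ z in box n, peak z ^ N by
      simpa only [sub_eq_add_neg] using hp.setIntegral_comp_add (-w)]
  refine integral_congr_ae (ae_of_all _ fun z => ?_)
  simp only [peakKernel, smul_eq_mul]
  rw [show z + (x - w) - x = z - w by abel]
  ring

/-- Lower semicontinuity of the determinant inequality under almost everywhere convergence
together with convergence of the means. -/
lemma setIntegral_det_rpow_le_of_tendsto {n : ℕ} {p : ℝ} (hp : 0 ≤ p)
    {B : ℕ → (Fin n → ℝ) → Matrix (Fin n) (Fin n) ℝ} {A : (Fin n → ℝ) → Matrix (Fin n) (Fin n) ℝ}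
    (hBc : ∀ N, Continuous (B N)) (hB : ∀ N x, (B N x).PosSemidef) (hA : ∀ x, (A x).PosSemidef)
    (hle : ∀ N, ∫ x in box n, (B N x).det ^ p ≤ (meanMatrix (B N)).det ^ p)
    (hmean : ∀ i j, Tendsto (fun N => meanMatrix (B N) i j) atTop (𝓝 (meanMatrix A i j)))
    (hae : ∀ᵐ x ∂volume.restrict (box n), ∀ i j, Tendsto (fun N => B N x i j) atTop (𝓝 (A x i j))) :
    IntegrableOn (fun x => (A x).det ^ p) (box n) ∧
      ∫ x in box n, (A x).det ^ p ≤ (meanMatrix A).det ^ p := by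
  have hdet : Continuous fun M : Matrix (Fin n) (Fin n) ℝ => M.det ^ p :=
    (continuous_id.matrix_det).rpow_const fun _ => Or.inr hp
  have hT : ∀ {C : ℕ → Matrix (Fin n) (Fin n) ℝ} {D : Matrix (Fin n) (Fin n) ℝ},
      (∀ i j, Tendsto (fun N => C N i j) atTop (𝓝 (D i j))) →
      Tendsto (fun N => (C N).det ^ p) atTop (𝓝 (D.det ^ p)) := fun h =>
    (hdet.tendsto _).comp (tendsto_pi_nhds.2 fun i => tendsto_pi_nhds.2 fun j => h i j)
  have hfc : ∀ N, Continuous fun x => (B N x).det ^ p := fun N => hdet.comp (hBc N)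
  have haeT : ∀ᵐ x ∂volume.restrict (box n),
      Tendsto (fun N => (B N x).det ^ p) atTop (𝓝 ((A x).det ^ p)) := hae.mono fun x hx => hT hx
  have hm : AEStronglyMeasurable (fun x => (A x).det ^ p) (volume.restrict (box n)) :=
    aestronglyMeasurable_of_tendsto_ae atTop (fun N => (hfc N).aestronglyMeasurable) haeT
  have h0 : ∀ x, 0 ≤ (A x).det ^ p := fun x => Real.rpow_nonneg (hA x).det_nonneg p
  have hbound : ∫⁻ x in box n, ENNReal.ofReal ((A x).det ^ p) ≤
      ENNReal.ofReal ((meanMatrix A).det ^ p) := by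
    calc ∫⁻ x in box n, ENNReal.ofReal ((A x).det ^ p)
        = ∫⁻ x in box n, liminf (fun N => ENNReal.ofReal ((B N x).det ^ p)) atTop :=
          lintegral_congr_ae (haeT.mono fun x hx =>
            ((ENNReal.continuous_ofReal.tendsto _).comp hx).liminf_eq.symm)
      _ ≤ liminf (fun N => ∫⁻ x in box n, ENNReal.ofReal ((B N x).det ^ p)) atTop :=
          lintegral_liminf_le fun N => (hfc N).measurable.ennreal_ofReal
      _ ≤ liminf (fun N => ENNReal.ofReal ((meanMatrix (B N)).det ^ p)) atTop := by
          refine liminf_le_liminf (Eventually.of_forall fun N => ?_)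
          rw [← ofReal_integral_eq_lintegral_ofReal (hfc N).integrableOn_box
            (ae_of_all _ fun x => Real.rpow_nonneg (hB N x).det_nonneg p)]
          exact ENNReal.ofReal_le_ofReal (hle N)
      _ = _ := ((ENNReal.continuous_ofReal.tendsto _).comp (hT hmean)).liminf_eq
  have h_int : IntegrableOn (fun x => (A x).det ^ p) (box n) := by
    refine ⟨hm, ?_⟩
    rw [hasFiniteIntegral_iff_ofReal (ae_of_all _ h0)]
    exact hbound.trans_lt ENNReal.ofReal_lt_top
  refine ⟨h_int, ?_⟩
  rw [integral_eq_lintegral_of_nonneg_ae (ae_of_all _ h0) hm]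
  have hDnn : 0 ≤ (meanMatrix A).det ^ p :=
    ge_of_tendsto' (hT hmean) fun N => (integral_nonneg fun x =>
      Real.rpow_nonneg (hB N x).det_nonneg p).trans (hle N)
  exact ENNReal.toReal_le_of_le_ofReal hDnn hbound

/-- The Fourier coefficients of the entries of a matrix field. -/
def fourierMatrix {n : ℕ} (A : (Fin n → ℝ) → Matrix (Fin n) (Fin n) ℝ) (k : Fin n → ℤ) :
    Matrix (Fin n) (Fin n) ℂ :=
  Matrix.of fun i l => ∫ x in box n, (A x i l : ℂ) * expi (-k) x

lemma fourierMatrix_zero {n : ℕ} (A : (Fin n → ℝ) → Matrix (Fin n) (Fin n) ℝ) (i l : Fin n) :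
    fourierMatrix A 0 i l = meanMatrix A i l := by
  simp [fourierMatrix, meanMatrix, expi_zero, integral_complex_ofReal]

/-- The mollification of a matrix field by `peakKernel`, made uniformly positive definite. -/
def peakSmoothing {n : ℕ} (A : (Fin n → ℝ) → Matrix (Fin n) (Fin n) ℝ) (N : ℕ) (x : Fin n → ℝ) :
    Matrix (Fin n) (Fin n) ℝ :=
  meanMatrix (fun y => peakKernel N (x - y) • A y) + (1 / ((N : ℝ) + 1)) • 1

lemma exists_peakSmoothing_eq_sum {n : ℕ} {A : (Fin n → ℝ) → Matrix (Fin n) (Fin n) ℝ}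
    (hA : Continuous A) (N : ℕ) :
    ∃ (J : Finset (Fin n → ℤ)) (κ : (Fin n → ℤ) → ℂ), 0 ∈ J ∧
      κ 0 = ((∫ y in box n, peakKernel N y : ℝ) : ℂ) ∧
      ∀ x i l, (peakSmoothing A N x i l : ℂ) = ∑ k ∈ J, (κ k * fourierMatrix A k i l +
        if k = 0 then (1 / ((N : ℂ) + 1)) * (1 : Matrix (Fin n) (Fin n) ℂ) i l else 0) *
          expi k x := by
  obtain ⟨J, κ, h0, hκ⟩ := exists_peakKernel_eq_sum (n := n) N
  refine ⟨J, κ, h0, ?_, fun x i l => ?_⟩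
  · rw [← integral_complex_ofReal]
    simp only [hκ, setIntegral_sum_expi κ h0]
  · simp only [add_mul, Finset.sum_add_distrib, ite_mul, zero_mul]
    rw [Finset.sum_ite_eq', if_pos h0, expi_zero, mul_one]
    simp only [peakSmoothing, Matrix.add_apply, Matrix.smul_apply, smul_eq_mul, meanMatrix,
      Matrix.of_apply, Complex.ofReal_add]
    congr 1
    · rw [← integral_complex_ofReal]
      simp only [Complex.ofReal_mul, hκ, Finset.sum_mul]
      rw [integral_finsetSum _ fun k _ => ?_]
      · refine Finset.sum_congr rfl fun k _ => ?_
        simp only [fourierMatrix, Matrix.of_apply]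
        rw [mul_right_comm, ← integral_const_mul]
        refine integral_congr_ae (ae_of_all _ fun y => ?_)
        simp only
        rw [sub_eq_add_neg, expi_add_right, expi_neg_right]
        ring
      · have := continuous_expi k
        exact Continuous.integrableOn_box (by fun_prop)
    · rw [Matrix.one_apply, Matrix.one_apply]
      split_ifs <;> simp

lemma setIntegral_det_rpow_le_of_continuous {n : ℕ} (hn : 2 ≤ n)
    {A : (Fin n → ℝ) → Matrix (Fin n) (Fin n) ℝ} (hAp : ZPeriodic A) (hA : Continuous A)
    (hpos : ∀ x, (A x).PosSemidef)
    (hdiv : ∀ (k : Fin n → ℤ) i, ∑ l, fourierMatrix A k i l * k l = 0) :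
    ∫ x in box n, (A x).det ^ ((1 : ℝ) / ((n : ℝ) - 1)) ≤
      (meanMatrix A).det ^ ((1 : ℝ) / ((n : ℝ) - 1)) := by
  have hn0 : n ≠ 0 := by omega
  choose J κ h0 hκ hsum using exists_peakSmoothing_eq_sum hA
  have hp : (0 : ℝ) ≤ 1 / ((n : ℝ) - 1) := by
    have : (2 : ℝ) ≤ n := by exact_mod_cast hn
    exact div_nonneg zero_le_one (by linarith)
  have hker : ∀ N x, (meanMatrix fun y => peakKernel N (x - y) • A y).PosSemidef := fun N x =>
    posSemidef_meanMatrix (fun i j => Continuous.integrableOn_box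
        (by have := continuous_peakKernel (n := n) N; simp only [Matrix.smul_apply]; fun_prop))
      fun y => (hpos y).smul (peakKernel_nonneg N _)
  have hθ : ∀ N : ℕ, 0 < 1 / ((N : ℝ) + 1) := fun N => by positivity
  have hone : ∀ N : ℕ, ((1 / ((N : ℝ) + 1)) • (1 : Matrix (Fin n) (Fin n) ℝ)).PosSemidef :=
    fun N => Matrix.PosSemidef.one.smul (hθ N).le
  have hB : ∀ N x, (peakSmoothing A N x).PosSemidef := fun N x => (hker N x).add (hone N)
  have hlow : ∀ (N : ℕ) (x v : Fin n → ℝ),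
      1 / ((N : ℝ) + 1) * (v ⬝ᵥ v) ≤ v ⬝ᵥ peakSmoothing A N x *ᵥ v := fun N x v => by
    have := (hker N x).dotProduct_mulVec_nonneg v
    rw [star_trivial] at this
    rw [peakSmoothing, Matrix.add_mulVec, dotProduct_add, Matrix.smul_mulVec, Matrix.one_mulVec,
      dotProduct_smul, smul_eq_mul]
    linarith
  have hBc : ∀ N, Continuous (peakSmoothing A N) := fun N => continuous_matrix fun i l => by
    have h : Continuous fun x => (peakSmoothing A N x i l : ℂ) := by
      simp only [hsum]
      exact continuous_finsetSum _ fun k _ => (continuous_expi k).const_mul _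
    simpa only [Function.comp_def, Complex.ofReal_re] using Complex.continuous_re.comp h
  have hθlim : Tendsto (fun N : ℕ => 1 / ((N : ℝ) + 1)) atTop (𝓝 0) :=
    tendsto_one_div_add_atTop_nhds_zero_nat
  refine (setIntegral_det_rpow_le_of_tendsto hp hBc hB hpos (fun N => ?_) (fun i l => ?_)
    (ae_of_all _ fun x i l => ?_)).2
  · refine setIntegral_det_rpow_le_of_trigPoly hn (hθ N) (J := J N)
      (a := fun k => κ N k • fourierMatrix A k + if k = 0 then (1 / ((N : ℂ) + 1)) • 1 else 0)
      (fun x i l => ?_)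
      (fun x => (hB N x).isHermitian) (hlow N) fun k hk i => ?_
    · rw [hsum]
      refine Finset.sum_congr rfl fun k _ => ?_
      split_ifs <;> simp
    · split_ifs with hk0
      · simp [hk0]
      · simp [mul_assoc, ← Finset.mul_sum, hdiv k i]
  · have h1 : ∀ N, meanMatrix (peakSmoothing A N) i l = (∫ y in box n, peakKernel N y) *
        meanMatrix A i l + 1 / ((N : ℝ) + 1) * (1 : Matrix (Fin n) (Fin n) ℝ) i l := fun N => by
      rw [← Complex.ofReal_inj, ← fourierMatrix_zero]
      rw [fourierMatrix, Matrix.of_apply]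
      simp only [hsum, neg_zero, expi_zero, mul_one]
      rw [setIntegral_sum_expi _ (h0 N), fourierMatrix_zero, hκ, if_pos rfl]
      push_cast
      congr 2
      rw [Matrix.one_apply, Matrix.one_apply]
      split_ifs <;> simp
    have h2 : Tendsto (fun N : ℕ => ∫ y : Fin n → ℝ in box n, peakKernel N y) atTop (𝓝 1) := by
      have := tendsto_setIntegral_peakKernel hn0 (G := fun _ => (1 : ℝ)) (fun _ _ => rfl)
        continuous_const 0
      simpa [peakKernel_neg] using this
    simp only [h1]
    simpa using (h2.mul_const (meanMatrix A i l)).add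
      (hθlim.mul_const ((1 : Matrix (Fin n) (Fin n) ℝ) i l))
  · have h2 := tendsto_setIntegral_peakKernel hn0 (G := fun y => A y i l)
      (fun y m => by simp only [hAp y m]) (by fun_prop) x
    simpa [peakSmoothing, meanMatrix] using h2.add
      (hθlim.mul_const ((1 : Matrix (Fin n) (Fin n) ℝ) i l))

lemma abs_apply_le_opNorm {n : ℕ} (M : Matrix (Fin n) (Fin n) ℝ) (i j : Fin n) :
    |M i j| ≤ opNorm M := by
  have h1 : Matrix.toEuclideanCLM (𝕜 := ℝ) M (EuclideanSpace.single j 1) i = M i j := by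
    simp
  rw [← h1, ← Real.norm_eq_abs]
  refine (PiLp.norm_apply_le _ i).trans ?_
  simpa [opNorm] using (Matrix.toEuclideanCLM (𝕜 := ℝ) M).le_opNorm (EuclideanSpace.single j 1)

lemma integrableOn_mul_expi {n : ℕ} {f : (Fin n → ℝ) → ℝ} (hf : IntegrableOn f (box n))
    (k : Fin n → ℤ) : IntegrableOn (fun x => (f x : ℂ) * expi k x) (box n) :=
  hf.ofReal.mul_bdd (c := 1) (continuous_expi k).aestronglyMeasurable
    (ae_of_all _ fun x => (norm_expi k x).le)

/-- The distributional divergence-free condition in terms of Fourier coefficients. -/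
lemma sum_fourierMatrix_mul_eq_zero {n : ℕ} {A : (Fin n → ℝ) → Matrix (Fin n) (Fin n) ℝ}
    (hi : ∀ i j, IntegrableOn (fun x => A x i j) (box n))
    (hdiv : ∀ Φ : (Fin n → ℝ) → Fin n → ℝ, ContDiff ℝ (⊤ : ℕ∞) Φ → ZPeriodic Φ →
      (∫ x in box n, ∑ i, ∑ j, A x i j * pd (fun y => Φ y i) j x) = 0)
    (k : Fin n → ℤ) (i : Fin n) : ∑ l, fourierMatrix A k i l * k l = 0 := by
  set W : ℂ := ∑ l, fourierMatrix A k i l * k l with hW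
  have hWi : W = ∫ x in box n, ∑ l, (A x i l : ℂ) * expi (-k) x * k l := by
    rw [integral_finsetSum _ fun l _ => (integrableOn_mul_expi (hi i l) _).mul_const _]
    simp only [integral_mul_const, hW, fourierMatrix, Matrix.of_apply]
  have key : ∀ ζ : ℂ, (ζ * W).re = 0 := fun ζ => by
    let ψ : (Fin n → ℝ) → ℝ :=
      fun y => (ζ * (Complex.I / (2 * Real.pi)) * expi (-k) y).re
    have hψ : ∀ x j, pd ψ j x = (ζ * expi (-k) x * k j).re := fun x j => by
      have h := Complex.reCLM.hasFDerivAt.comp x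
        ((hasFDerivAt_expi (-k) x).const_mul (ζ * (Complex.I / (2 * Real.pi))))
      have hpi : (Real.pi : ℂ) ≠ 0 := by exact_mod_cast Real.pi_ne_zero
      rw [pd, show fderiv ℝ ψ x = _ from h.fderiv]
      simp only [ContinuousLinearMap.comp_apply, smul_apply, smul_eq_mul, Complex.reCLM_apply,
        Complex.ofRealCLM_apply, phase_apply]
      rw [Finset.sum_eq_single j (by intro b _ hb; simp [hb]) (by simp), Pi.single_eq_same]
      congr 1
      push_cast [Pi.neg_apply]
      field_simp
      linear_combination (-ζ * expi (-k) x * k j) * Complex.I_sq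
    have h0 := hdiv (fun y => Pi.single i (ψ y))
      (contDiff_pi.2 fun i' => by
        by_cases h : i' = i
        · subst h
          simp only [Pi.single_eq_same]
          exact Complex.reCLM.contDiff.comp (contDiff_const.mul (contDiff_expi _))
        · simp only [Pi.single_eq_of_ne h]
          exact contDiff_const)
      (fun x m => by simp only [ψ, zPeriodic_expi _ x m])
    have h1 : ∀ x, ∑ i', ∑ j, A x i' j * pd (fun y => (Pi.single i (ψ y) : Fin n → ℝ) i') j x =
        Complex.reCLM (ζ * ∑ l, (A x i l : ℂ) * expi (-k) x * k l) := fun x => by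
      rw [Finset.sum_eq_single i (fun b _ hb => by simp [Pi.single_eq_of_ne hb, pd]) (by simp)]
      simp only [Pi.single_eq_same]
      rw [Finset.mul_sum, map_sum]
      refine Finset.sum_congr rfl fun j _ => ?_
      rw [show pd (fun y => ψ y) j x = _ from hψ x j, ← Complex.re_ofReal_mul,
        Complex.reCLM_apply]
      congr 1
      ring
    simp only [h1] at h0
    rw [Complex.reCLM.integral_comp_comm (Integrable.const_mul (integrable_finsetSum _ fun l _ =>
      (integrableOn_mul_expi (hi i l) _).mul_const _) ζ), integral_const_mul, ← hWi] at h0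
    exact h0
  have := key (conj W)
  rw [mul_comm, Complex.mul_conj, Complex.ofReal_re] at this
  exact Complex.normSq_eq_zero.1 this

/-- Entrywise mollification of a matrix field. -/
def mollify {n : ℕ} (φ : ContDiffBump (0 : Fin n → ℝ))
    (A : (Fin n → ℝ) → Matrix (Fin n) (Fin n) ℝ) (x : Fin n → ℝ) : Matrix (Fin n) (Fin n) ℝ :=
  Matrix.of fun i l => ∫ t, φ.normed volume t * A (x - t) i l

lemma mollify_apply {n : ℕ} (φ : ContDiffBump (0 : Fin n → ℝ))
    (A : (Fin n → ℝ) → Matrix (Fin n) (Fin n) ℝ) (x : Fin n → ℝ) (i l : Fin n) :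
    mollify φ A x i l =
      (φ.normed volume ⋆[ContinuousLinearMap.lsmul ℝ ℝ, volume] fun y => A y i l) x := rfl

section Mollify

variable {n : ℕ} (φ : ContDiffBump (0 : Fin n → ℝ)) {A : (Fin n → ℝ) → Matrix (Fin n) (Fin n) ℝ}

lemma continuous_mollify (hA : ∀ i l, LocallyIntegrable fun x => A x i l) :
    Continuous (mollify φ A) :=
  continuous_matrix fun i l => by
    simp only [mollify_apply]
    exact φ.hasCompactSupport_normed.continuous_convolution_left _ φ.continuous_normed (hA i l)

lemma zPeriodic_mollify (hA : ZPeriodic A) : ZPeriodic (mollify φ A) := fun x m => by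
  simp only [mollify, add_sub_right_comm, hA _ m]

lemma posSemidef_mollify (hA : ∀ i l, LocallyIntegrable fun x => A x i l)
    (hpos : ∀ x, (A x).PosSemidef) (x : Fin n → ℝ) : (mollify φ A x).PosSemidef := by
  have hi : ∀ i l, Integrable fun t => φ.normed volume t * A (x - t) i l := fun i l =>
    φ.hasCompactSupport_normed.convolutionExists_left (ContinuousLinearMap.lsmul ℝ ℝ)
      φ.continuous_normed (hA i l) x
  refine Matrix.PosSemidef.of_dotProduct_mulVec_nonneg ?_ fun v => ?_
  · ext i l
    simp only [mollify, Matrix.conjTranspose_apply, Matrix.of_apply, star_trivial]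
    exact integral_congr_ae (ae_of_all _ fun t => by
      simpa using Or.inl ((hpos (x - t)).isHermitian.apply i l))
  · have h : star v ⬝ᵥ mollify φ A x *ᵥ v =
        ∫ t, φ.normed volume t * (v ⬝ᵥ A (x - t) *ᵥ v) := by
      simp only [star_trivial, dotProduct, Matrix.mulVec, mollify, Matrix.of_apply, Finset.mul_sum]
      have hv : ∀ i l, Integrable fun t => φ.normed volume t * (v i * (A (x - t) i l * v l)) :=
        fun i l => (((hi i l).mul_const (v l)).const_mul (v i)).congr
          (ae_of_all _ fun t => by simp only; ring)
      rw [integral_finsetSum _ fun i _ => integrable_finsetSum _ fun l _ => hv i l]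
      refine Finset.sum_congr rfl fun i _ => ?_
      rw [integral_finsetSum _ fun l _ => hv i l]
      refine Finset.sum_congr rfl fun l _ => ?_
      rw [← integral_mul_const, ← integral_const_mul]
      exact integral_congr_ae (ae_of_all _ fun t => by simp only; ring)
    rw [h]
    exact integral_nonneg fun t => mul_nonneg (φ.nonneg_normed t)
      (by simpa using (hpos (x - t)).dotProduct_mulVec_nonneg v)

lemma fourierMatrix_mollify (hmeas : ∀ i j, Measurable fun x => A x i j) (hA : ZPeriodic A)
    (hi : ∀ i j, IntegrableOn (fun x => A x i j) (box n)) (k : Fin n → ℤ) (i l : Fin n) :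
    fourierMatrix (mollify φ A) k i l =
      (∫ t, (φ.normed volume t : ℂ) * expi (-k) t) * fourierMatrix A k i l := by
  have hp : ZPeriodic fun x => A x i l := fun x m => by simp only [hA x m]
  have hpe : ZPeriodic fun x => (A x i l : ℂ) * expi (-k) x := fun x m => by
    simp only [hA x m, zPeriodic_expi _ x m]
  have hpn : ZPeriodic fun x => |A x i l| := fun x m => by simp only [hA x m]
  let f : (Fin n → ℝ) → (Fin n → ℝ) → ℂ := fun x t =>
    (φ.normed volume t : ℂ) * ((A (x - t) i l : ℂ) * expi (-k) x)
  have hf : Integrable (Function.uncurry f) ((volume.restrict (box n)).prod volume) := by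
    have hsm : Measurable (Function.uncurry f) := by
      have h1 := φ.continuous_normed (μ := volume)
      have h2 := (continuous_expi (-k)).measurable
      have h3 : Measurable fun p : (Fin n → ℝ) × (Fin n → ℝ) => A (p.1 - p.2) i l :=
        (hmeas i l).comp (measurable_fst.sub measurable_snd)
      exact (Complex.measurable_ofReal.comp (h1.measurable.comp measurable_snd)).mul
        ((Complex.measurable_ofReal.comp h3).mul (h2.comp measurable_fst))
    refine (integrable_prod_iff' hsm.aestronglyMeasurable).2 ⟨ae_of_all _ fun t => ?_, ?_⟩
    · have := hp.integrableOn_comp_add (hi i l) (-t)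
      simp only [← sub_eq_add_neg] at this
      exact (integrableOn_mul_expi this (-k)).const_mul (φ.normed volume t : ℂ)
    · have h1 : ∀ t, ∫ x in box n, ‖Function.uncurry f (x, t)‖ =
          φ.normed volume t * ∫ x in box n, |A x i l| := fun t => by
        rw [← hpn.setIntegral_comp_add (-t), ← integral_const_mul]
        simp [f, Function.uncurry, norm_expi, abs_of_nonneg (φ.nonneg_normed t), sub_eq_add_neg]
      simp only [h1]
      exact φ.integrable_normed.mul_const _
  calc fourierMatrix (mollify φ A) k i l = ∫ x in box n, ∫ t, f x t := by
        simp only [fourierMatrix, mollify, Matrix.of_apply, f]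
        refine integral_congr_ae (ae_of_all _ fun x => ?_)
        simp only
        rw [← integral_complex_ofReal, ← integral_mul_const]
        refine integral_congr_ae (ae_of_all _ fun t => ?_)
        push_cast
        ring
    _ = ∫ t, ∫ x in box n, f x t := integral_integral_swap hf
    _ = ∫ t, (φ.normed volume t : ℂ) * expi (-k) t * fourierMatrix A k i l := by
        refine integral_congr_ae (ae_of_all _ fun t => ?_)
        have h : ∀ x, (A (x - t) i l : ℂ) * expi (-k) x =
            expi (-k) t * ((A (x + -t) i l : ℂ) * expi (-k) (x + -t)) := fun x => by
          rw [show expi (-k) x = expi (-k) t * expi (-k) (x + -t) by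
            rw [← expi_add_right]; congr 1; abel, ← sub_eq_add_neg]
          ring
        simp only [f, fourierMatrix, Matrix.of_apply, h, integral_const_mul]
        rw [mul_assoc, hpe.setIntegral_comp_add (-t)]
    _ = _ := integral_mul_const _ _

lemma meanMatrix_mollify (hmeas : ∀ i j, Measurable fun x => A x i j) (hA : ZPeriodic A)
    (hi : ∀ i j, IntegrableOn (fun x => A x i j) (box n)) :
    meanMatrix (mollify φ A) = meanMatrix A := by
  ext i l
  have h := fourierMatrix_mollify φ hmeas hA hi 0 i l
  simp only [fourierMatrix_zero, neg_zero, expi_zero, mul_one] at h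
  rw [integral_complex_ofReal, φ.integral_normed, Complex.ofReal_one, one_mul] at h
  exact_mod_cast h

end Mollify

end Torus

/-- **Divergence-quasiconcavity of the determinant functional (Serre).**
If `A ∈ L^1(𝕋^n, Sym^+(n))` is divergence-free in the sense of distributions, then
`det(A)^{1/(n-1)}` is integrable and
`∫ det(A)^{1/(n-1)} ≤ det(∫ A)^{1/(n-1)}`. -/
theorem det_quasiconcavity_of_divFree
    (n : ℕ) (hn : 2 ≤ n)
    (A : (Fin n → ℝ) → Matrix (Fin n) (Fin n) ℝ)
    (hmeas : ∀ i j, Measurable fun x => A x i j)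
    (hper : ZPeriodic A)
    (hpos : ∀ x, (A x).PosSemidef)
    (hL1 : IntegrableOn (fun x => opNorm (A x)) (box n))
    (hdivfree : ∀ Φ : (Fin n → ℝ) → Fin n → ℝ, ContDiff ℝ (⊤ : ℕ∞) Φ → ZPeriodic Φ →
      (∫ x in box n, ∑ i, ∑ j, A x i j * pd (fun y => Φ y i) j x) = 0) :
    IntegrableOn (fun x => (A x).det ^ ((1:ℝ)/((n:ℝ)-1))) (box n) ∧
    (∫ x in box n, (A x).det ^ ((1:ℝ)/((n:ℝ)-1)))
      ≤ (Matrix.det (Matrix.of fun i j => ∫ x in box n, A x i j)) ^ ((1:ℝ)/((n:ℝ)-1)) := by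
  have hi : ∀ i j, IntegrableOn (fun x => A x i j) (box n) := fun i j =>
    hL1.mono' (hmeas i j).aestronglyMeasurable
      (ae_of_all _ fun x => abs_apply_le_opNorm (A x) i j)
  have hloc : ∀ i j, LocallyIntegrable fun x => A x i j := fun i j =>
    ZPeriodic.locallyIntegrable (fun x m => by simp only [hper x m]) (hi i j)
  have hp : (0 : ℝ) ≤ 1 / ((n : ℝ) - 1) := by
    have : (2 : ℝ) ≤ n := by exact_mod_cast hn
    exact div_nonneg zero_le_one (by linarith)
  let φ : ℕ → ContDiffBump (0 : Fin n → ℝ) := fun N =>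
    ⟨1 / (N + 1), 2 * (1 / (N + 1)), by positivity, by
      have : (0 : ℝ) < 1 / (N + 1) := by positivity
      linarith⟩
  have hφ : Tendsto (fun N => (φ N).rOut) atTop (𝓝 0) := by
    have h := (tendsto_one_div_add_atTop_nhds_zero_nat (𝕜 := ℝ)).const_mul 2
    rwa [mul_zero] at h
  refine setIntegral_det_rpow_le_of_tendsto hp (B := fun N => mollify (φ N) A)
    (fun N => continuous_mollify _ hloc) (fun N x => posSemidef_mollify _ hloc hpos x) hpos
    (fun N => ?_) (fun i j => ?_) (ae_restrict_of_ae ?_)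
  · refine setIntegral_det_rpow_le_of_continuous hn (zPeriodic_mollify _ hper)
      (continuous_mollify _ hloc) (fun x => posSemidef_mollify _ hloc hpos x) fun k i => ?_
    simp only [fourierMatrix_mollify _ hmeas hper hi, mul_assoc]
    rw [← Finset.mul_sum, sum_fourierMatrix_mul_eq_zero hi hdivfree, mul_zero]
  · simp only [meanMatrix_mollify _ hmeas hper hi]
    exact tendsto_const_nhds
  · refine ae_all_iff.2 fun i => ae_all_iff.2 fun j => ?_
    simp only [mollify_apply]
    exact ContDiffBump.ae_convolution_tendsto_right_of_locallyIntegrable hφ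
      (K := 2) (Eventually.of_forall fun N => le_rfl) (hloc i j)
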